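/- arXiv:2407.06398 — 2 statements merged into one kernel-verified Lean document; each statement's English description precedes it below -/
import Mathlib

section
/- Let μ be a Borel probability measure on ℝ satisfying the basic assumptions, let k ≥ 1, and let v ∈ (0,1)ᵏ be nondecreasing. Assume in addition that either μ has compact support or ∫ |x|^{2+δ} dμ < ∞ for some δ > 0. Then there exists a constant C > 0 such that for all n > k, | (∫_{ℝⁿ} SC_v d(μ^{⊗n})) / (∫_{ℝⁿ} SC_opt d(μ^{⊗n})) − W₁(μ, ν_{Q_v}) / (inf_{ν ∈ 𝒫_k(ℝ)} W₁(μ, ν)) | ≤ C·n^{−1/2}; in particular, for all n > k the Bayesian approximation ratio of PM_v is at most W₁(μ, ν_{Q_v})/(inf_{ν ∈ 𝒫_k(ℝ)} W₁(μ,ν)) + C/√n. -/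
open MeasureTheory Filter Topology ENNReal

/-- The 1-Wasserstein distance between two measures on ℝ, defined as the infimum of
transport costs over couplings. -/
noncomputable def W1 (α β : Measure ℝ) : ℝ :=
  sInf {c : ℝ | ∃ π : Measure (ℝ × ℝ), IsProbabilityMeasure π ∧
    π.map Prod.fst = α ∧ π.map Prod.snd = β ∧ c = ∫ p, |p.1 - p.2| ∂π}

/-- The ∞-Wasserstein distance between two measures on ℝ. -/
noncomputable def Winf (α β : Measure ℝ) : ℝ :=
  sInf {c : ℝ | ∃ π : Measure (ℝ × ℝ), IsProbabilityMeasure π ∧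
    π.map Prod.fst = α ∧ π.map Prod.snd = β ∧
    c = essSup (fun p : ℝ × ℝ => |p.1 - p.2|) π}

/-- `Pk k` : probability measures on ℝ supported on at most `k` points. -/
def Pk (k : ℕ) : Set (Measure ℝ) :=
  {ν | IsProbabilityMeasure ν ∧ ∃ s : Finset ℝ, s.card ≤ k ∧ ν ((↑s : Set ℝ)ᶜ) = 0}

/-- Wasserstein projection distance of `μ` onto `k`-point measures. -/
noncomputable def projDist (k : ℕ) (μ : Measure ℝ) : ℝ :=
  sInf {c : ℝ | ∃ ν ∈ Pk k, c = W1 μ ν}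

/-- Empirical measure of a tuple of points. -/
noncomputable def empMeas {n : ℕ} (x : Fin n → ℝ) : Measure ℝ :=
  ((n : ℝ≥0∞))⁻¹ • ∑ i : Fin n, Measure.dirac (x i)

/-- Social cost of facility placement `y` for agents at `x`. -/
noncomputable def SC {n k : ℕ} (x : Fin n → ℝ) (y : Fin k → ℝ) : ℝ :=
  (n : ℝ)⁻¹ * ∑ i : Fin n, ⨅ j : Fin k, |x i - y j|

/-- Optimal social cost for `k` facilities. -/
noncomputable def SCopt (k : ℕ) {n : ℕ} (x : Fin n → ℝ) : ℝ :=
  ⨅ y : Fin k → ℝ, SC x y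

/-- Topological support of a measure on ℝ. -/
def msupport (ν : Measure ℝ) : Set ℝ := {t : ℝ | ∀ U ∈ nhds t, ν U ≠ 0}

/-- Cumulative distribution function of a measure on ℝ. -/
noncomputable def mcdf (μ : Measure ℝ) (t : ℝ) : ℝ := (μ (Set.Iic t)).toReal

/-- Quantile (generalized inverse c.d.f.) of a measure on ℝ. -/
noncomputable def mquantile (μ : Measure ℝ) (v : ℝ) : ℝ := sInf {t : ℝ | v ≤ mcdf μ t}

/-- Basic assumptions: `μ` is an absolutely continuous probability measure with density `ρ`,
supported on a (closed) interval `S`, with `ρ` positive on the interior of `S`, vanishing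
outside `S`, and differentiable on `S`. -/
def BasicAssumptions (μ : Measure ℝ) : Prop :=
  IsProbabilityMeasure μ ∧
  ∃ (ρ : ℝ → ℝ) (S : Set ℝ),
    μ = volume.withDensity (fun x => ENNReal.ofReal (ρ x)) ∧
    IsClosed S ∧ S.OrdConnected ∧ μ Sᶜ = 0 ∧
    (∀ x ∈ interior S, 0 < ρ x) ∧ (∀ x ∉ S, ρ x = 0) ∧
    DifferentiableOn ℝ ρ S

/-- The percentile mechanism: facility `j` is placed at the `(⌊(n-1)vⱼ⌋+1)`-th smallest
coordinate of `x`. -/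
noncomputable def percentileMech {k : ℕ} (v : Fin k → ℝ) {n : ℕ} (x : Fin n → ℝ) :
    Fin k → ℝ :=
  fun j =>
    if h : 0 < n then
      x (Tuple.sort x ⟨min ⌊((n : ℝ) - 1) * v j⌋₊ (n - 1),
        Nat.lt_of_le_of_lt (min_le_right _ _) (by omega)⟩)
    else 0

/-- Social cost of the percentile mechanism with percentile vector `v`. -/
noncomputable def SCv {k : ℕ} (v : Fin k → ℝ) {n : ℕ} (x : Fin n → ℝ) : ℝ :=
  SC x (percentileMech v x)

/-- Cumulative masses of the Voronoi cells of the points `y 0 < y 1 < ⋯ < y (k-1)`: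
`cellBd μ y j = F_μ(z_j)` where `z_j = (y (j-1) + y j)/2` for `1 ≤ j ≤ k-1` (1-based),
with the conventions `F_μ(z_0) = 0` and `F_μ(z_k) = 1`. -/
noncomputable def cellBd (μ : Measure ℝ) {k : ℕ} (y : Fin k → ℝ) (j : ℕ) : ℝ :=
  if h0 : j = 0 then 0
  else if hk : k ≤ j then 1
  else mcdf μ ((y ⟨j - 1, by omega⟩ + y ⟨j, by omega⟩) / 2)

/-- The measure `ν_{Q_v}`: atoms at the quantiles `F_μ^{[-1]}(vⱼ)` weighted by the masses of
their Voronoi cells. -/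
noncomputable def nuQ (μ : Measure ℝ) {k : ℕ} (v : Fin k → ℝ) : Measure ℝ :=
  ∑ i : Fin k,
    ENNReal.ofReal (cellBd μ (fun j => mquantile μ (v j)) ((i : ℕ) + 1) -
        cellBd μ (fun j => mquantile μ (v j)) (i : ℕ)) •
      Measure.dirac (mquantile μ (v i))

/-- Distance from `t` to the nearest of the points `y j`. -/
noncomputable def nearestDist {k : ℕ} (y : Fin k → ℝ) (t : ℝ) : ℝ := ⨅ j, |t - y j|

lemma nearestDist_le {k : ℕ} (y : Fin k → ℝ) (t : ℝ) (j : Fin k) :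
    nearestDist y t ≤ |t - y j| :=
  ciInf_le ⟨0, by rintro _ ⟨j, rfl⟩; exact abs_nonneg _⟩ j

lemma nearestDist_nonneg {k : ℕ} (y : Fin k → ℝ) (t : ℝ) : 0 ≤ nearestDist y t :=
  Real.iInf_nonneg fun _ => abs_nonneg _

lemma nearestDist_sub_le {k : ℕ} [NeZero k] (y : Fin k → ℝ) (s t : ℝ) :
    nearestDist y s ≤ nearestDist y t + |s - t| := by
  rw [← sub_le_iff_le_add]
  refine le_ciInf fun j => ?_
  linarith [nearestDist_le y s j, abs_sub_le s t (y j)]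

lemma nearestDist_lipschitz {k : ℕ} [NeZero k] (y : Fin k → ℝ) :
    LipschitzWith 1 (nearestDist y) := by
  refine LipschitzWith.of_le_add fun s t => ?_
  simpa [Real.dist_eq] using nearestDist_sub_le y s t

lemma nearestDist_le_add_sum {k : ℕ} [NeZero k] (y y' : Fin k → ℝ) (t : ℝ) :
    nearestDist y t ≤ nearestDist y' t + ∑ j, |y j - y' j| := by
  rw [← sub_le_iff_le_add]
  refine le_ciInf fun j => ?_
  have h := Finset.single_le_sum (f := fun j => |y j - y' j|)
    (fun i _ => abs_nonneg _) (Finset.mem_univ j)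
  have h2 := abs_sub_le t (y' j) (y j)
  rw [abs_sub_comm (y' j)] at h2
  linarith [nearestDist_le y t j]

lemma nearestDist_integrable {k : ℕ} [NeZero k] {μ : Measure ℝ} [IsFiniteMeasure μ]
    (hμ : Integrable id μ) (y : Fin k → ℝ) : Integrable (nearestDist y) μ := by
  refine ((hμ.sub (integrable_const (y 0))).abs).mono'
    (nearestDist_lipschitz y).continuous.aestronglyMeasurable (ae_of_all _ fun t => ?_)
  rw [Real.norm_of_nonneg (nearestDist_nonneg _ _)]
  simpa using nearestDist_le y t 0

lemma nearestDist_comp_perm {k : ℕ} (y : Fin k → ℝ) (σ : Equiv.Perm (Fin k)) :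
    nearestDist (y ∘ σ) = nearestDist y := by
  funext t
  exact σ.iInf_congr fun _ => rfl

/-- Points `y` weighted by the masses of the Voronoi cells they generate. -/
noncomputable def voronoiMeasure (μ : Measure ℝ) {k : ℕ} (y : Fin k → ℝ) : Measure ℝ :=
  ∑ i : Fin k, ENNReal.ofReal (cellBd μ y ((i : ℕ) + 1) - cellBd μ y (i : ℕ)) •
    Measure.dirac (y i)

/-- Union of the first `j` Voronoi cells of the points `y`. -/
def cellUnion {k : ℕ} (y : Fin k → ℝ) (j : ℕ) : Set ℝ :=
  if h0 : j = 0 then ∅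
  else if hk : k ≤ j then Set.univ
  else Set.Iic ((y ⟨j - 1, by omega⟩ + y ⟨j, by omega⟩) / 2)

lemma cellUnion_measurable {k : ℕ} (y : Fin k → ℝ) (j : ℕ) : MeasurableSet (cellUnion y j) := by
  unfold cellUnion
  split_ifs <;> measurability

lemma cellBd_eq {μ : Measure ℝ} [IsProbabilityMeasure μ] {k : ℕ} (y : Fin k → ℝ) (j : ℕ) :
    cellBd μ y j = μ.real (cellUnion y j) := by
  unfold cellBd cellUnion
  split_ifs <;> simp [mcdf, Measure.real]

lemma cellUnion_mono {k : ℕ} {y : Fin k → ℝ} (hy : Monotone y) : Monotone (cellUnion y) := by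
  refine monotone_nat_of_le_succ fun j => ?_
  unfold cellUnion
  by_cases h0 : j = 0
  · simp [h0]
  by_cases hk : k ≤ j + 1
  · simp [hk]
  have hk' : ¬ k ≤ j := by omega
  simp only [h0, hk, hk', dite_false, Nat.add_eq_zero_iff, false_and]
  refine Set.Iic_subset_Iic.2 ?_
  have h1 : y ⟨j - 1, by omega⟩ ≤ y ⟨j + 1 - 1, by omega⟩ := hy (by simp [Fin.le_def])
  have h2 : y ⟨j, by omega⟩ ≤ y ⟨j + 1, by omega⟩ := hy (by simp [Fin.le_def])
  linarith

/-- The Voronoi cell of the point `y i`. -/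
def voronoiCell {k : ℕ} (y : Fin k → ℝ) (i : Fin k) : Set ℝ :=
  cellUnion y (i + 1) \ cellUnion y i

lemma voronoiCell_measurable {k : ℕ} (y : Fin k → ℝ) (i : Fin k) :
    MeasurableSet (voronoiCell y i) :=
  (cellUnion_measurable _ _).diff (cellUnion_measurable _ _)

lemma voronoiCell_disjoint {k : ℕ} {y : Fin k → ℝ} (hy : Monotone y) :
    Pairwise (Function.onFun Disjoint (voronoiCell y)) := by
  have key : ∀ i j : Fin k, i < j → Disjoint (voronoiCell y i) (voronoiCell y j) := by
    intro i j hij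
    refine Set.disjoint_left.2 fun x hx hx' => hx'.2 ?_
    exact cellUnion_mono hy (show (i : ℕ) + 1 ≤ j from hij) hx.1
  intro i j hij
  rcases lt_or_gt_of_ne hij with h | h
  · exact key i j h
  · exact (key j i h).symm

lemma iUnion_voronoiCell {k : ℕ} [NeZero k] (y : Fin k → ℝ) :
    ⋃ i, voronoiCell y i = Set.univ := by
  classical
  refine Set.eq_univ_of_forall fun x => ?_
  have hk : x ∈ cellUnion y k := by simp [cellUnion, NeZero.ne k]
  have hex : ∃ j, x ∈ cellUnion y j := ⟨k, hk⟩
  have h0 : Nat.find hex ≠ 0 := by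
    intro h
    have := Nat.find_spec hex
    rw [h] at this
    simp [cellUnion] at this
  have hle : Nat.find hex ≤ k := Nat.find_min' hex hk
  refine Set.mem_iUnion.2 ⟨⟨Nat.find hex - 1, by omega⟩, ?_, ?_⟩
  · have : Nat.find hex - 1 + 1 = Nat.find hex := by omega
    simpa [this] using Nat.find_spec hex
  · exact Nat.find_min hex (by simp only; omega)

lemma measure_voronoiCell {μ : Measure ℝ} [IsProbabilityMeasure μ] {k : ℕ} {y : Fin k → ℝ}
    (hy : Monotone y) (i : Fin k) :
    ENNReal.ofReal (cellBd μ y ((i : ℕ) + 1) - cellBd μ y (i : ℕ)) = μ (voronoiCell y i) := by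
  rw [cellBd_eq, cellBd_eq, ← measureReal_sdiff (cellUnion_mono hy (Nat.le_succ _))
    (cellUnion_measurable _ _)]
  exact ofReal_measureReal

lemma abs_sub_le_of_mem_voronoiCell {k : ℕ} [NeZero k] {y : Fin k → ℝ} (hy : Monotone y)
    {i : Fin k} {x : ℝ} (hx : x ∈ voronoiCell y i) : |x - y i| = nearestDist y x := by
  refine le_antisymm (le_ciInf fun j => ?_) (nearestDist_le _ _ _)
  rcases lt_trichotomy i j with h | rfl | h
  · have hxi := hx.1
    have hk : ¬ k ≤ (i : ℕ) + 1 := by have := j.2; have : (i : ℕ) < j := h; omega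
    simp only [cellUnion, hk, dite_false, Nat.add_eq_zero_iff, one_ne_zero, and_false,
      Nat.add_sub_cancel, Set.mem_Iic] at hxi
    have h1 : y ⟨i + 1, by omega⟩ ≤ y j := hy (show (i : ℕ) + 1 ≤ j from h)
    have h2 : y i ≤ y ⟨i + 1, by omega⟩ := hy (by simp [Fin.le_def])
    rw [abs_sub_comm x (y j)]
    refine le_trans ?_ (le_abs_self _)
    rw [abs_le]; constructor <;> linarith
  · rfl
  · have hxi := hx.2
    have h' : (j : ℕ) < i := h
    have hi0 : (i : ℕ) ≠ 0 := by omega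
    have hk : ¬ k ≤ (i : ℕ) := by have := i.2; omega
    simp only [cellUnion, hk, hi0, dite_false, Set.mem_Iic, not_le] at hxi
    have h1 : y j ≤ y ⟨i - 1, by omega⟩ := hy (show (j : ℕ) ≤ i - 1 by omega)
    have h2 : y ⟨i - 1, by omega⟩ ≤ y i := hy (show (i : ℕ) - 1 ≤ i by omega)
    simp only [Fin.eta] at hxi
    refine le_trans ?_ (le_abs_self _)
    rw [abs_le]; constructor <;> linarith

/-- The coupling of `μ` with its Voronoi discretisation that sends each point to a nearest one
among the `y j`. -/
noncomputable def voronoiCoupling (μ : Measure ℝ) {k : ℕ} (y : Fin k → ℝ) : Measure (ℝ × ℝ) :=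
  ∑ i : Fin k, (μ.restrict (voronoiCell y i)).map fun x => (x, y i)

lemma voronoiCoupling_fst {μ : Measure ℝ} {k : ℕ} [NeZero k] {y : Fin k → ℝ}
    (hy : Monotone y) : (voronoiCoupling μ y).map Prod.fst = μ := by
  rw [voronoiCoupling, ← Measure.mapₗ_apply_of_measurable measurable_fst, map_sum]
  have : ∀ i, Measure.mapₗ Prod.fst ((μ.restrict (voronoiCell y i)).map fun x => (x, y i)) =
      μ.restrict (voronoiCell y i) := by
    intro i
    rw [Measure.mapₗ_apply_of_measurable measurable_fst,
      Measure.map_map measurable_fst (by fun_prop)]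
    exact Measure.map_id
  simp_rw [this]
  rw [← Measure.sum_fintype, ← Measure.restrict_iUnion (voronoiCell_disjoint hy)
    (voronoiCell_measurable y), iUnion_voronoiCell, Measure.restrict_univ]

lemma voronoiCoupling_snd {μ : Measure ℝ} [IsProbabilityMeasure μ] {k : ℕ} [NeZero k]
    {y : Fin k → ℝ} (hy : Monotone y) :
    (voronoiCoupling μ y).map Prod.snd = voronoiMeasure μ y := by
  rw [voronoiCoupling, ← Measure.mapₗ_apply_of_measurable measurable_snd, map_sum, voronoiMeasure]
  refine Finset.sum_congr rfl fun i _ => ?_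
  rw [Measure.mapₗ_apply_of_measurable measurable_snd,
      Measure.map_map measurable_snd (by fun_prop), measure_voronoiCell hy]
  change Measure.map (fun _ => y i) _ = _
  rw [Measure.map_const, Measure.restrict_apply_univ]

lemma voronoiCoupling_isProbabilityMeasure {μ : Measure ℝ} [IsProbabilityMeasure μ] {k : ℕ}
    [NeZero k] {y : Fin k → ℝ} (hy : Monotone y) :
    IsProbabilityMeasure (voronoiCoupling μ y) := by
  refine ⟨?_⟩
  have h := congrArg (fun ν : Measure ℝ => ν Set.univ) (voronoiCoupling_fst (μ := μ) hy)
  simpa [Measure.map_apply measurable_fst MeasurableSet.univ] using h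

lemma integral_voronoiCoupling {μ : Measure ℝ} [IsProbabilityMeasure μ] (hμ : Integrable id μ)
    {k : ℕ} [NeZero k] {y : Fin k → ℝ} (hy : Monotone y) :
    ∫ p, |p.1 - p.2| ∂(voronoiCoupling μ y) = ∫ x, nearestDist y x ∂μ := by
  have hm : ∀ i, AEStronglyMeasurable (fun p : ℝ × ℝ => |p.1 - p.2|)
      ((μ.restrict (voronoiCell y i)).map fun x => (x, y i)) := fun i =>
    Continuous.aestronglyMeasurable (by fun_prop)
  rw [voronoiCoupling, integral_finsetSum_measure]
  · have : ∫ x, nearestDist y x ∂μ = ∑ i, ∫ x in voronoiCell y i, nearestDist y x ∂μ := by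
      rw [← setIntegral_univ, ← iUnion_voronoiCell y,
        integral_iUnion_fintype (voronoiCell_measurable y) (voronoiCell_disjoint hy)]
      exact fun i => (nearestDist_integrable hμ y).integrableOn
    rw [this]
    refine Finset.sum_congr rfl fun i _ => ?_
    rw [integral_map (by fun_prop) (hm i)]
    exact setIntegral_congr_fun (voronoiCell_measurable y i)
      fun x hx => abs_sub_le_of_mem_voronoiCell hy hx
  · intro i _
    rw [integrable_map_measure (hm i) (by fun_prop)]
    exact ((hμ.sub (integrable_const (y i))).abs).integrableOn

lemma voronoiMeasure_mem_Pk {μ : Measure ℝ} [IsProbabilityMeasure μ] {k : ℕ} [NeZero k]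
    {y : Fin k → ℝ} (hy : Monotone y) : voronoiMeasure μ y ∈ Pk k := by
  refine ⟨?_, Finset.univ.image y, ?_, ?_⟩
  · rw [← voronoiCoupling_snd hy]
    have := voronoiCoupling_isProbabilityMeasure (μ := μ) hy
    exact Measure.isProbabilityMeasure_map measurable_snd.aemeasurable
  · simpa using Finset.card_image_le (s := Finset.univ) (f := y)
  · simp [voronoiMeasure]

lemma W1_nonneg (α β : Measure ℝ) : 0 ≤ W1 α β := by
  refine Real.sInf_nonneg ?_
  rintro _ ⟨π, -, -, -, rfl⟩
  exact integral_nonneg fun _ => abs_nonneg _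

lemma W1_voronoiMeasure_le {μ : Measure ℝ} [IsProbabilityMeasure μ] (hμ : Integrable id μ)
    {k : ℕ} [NeZero k] {y : Fin k → ℝ} (hy : Monotone y) :
    W1 μ (voronoiMeasure μ y) ≤ ∫ x, nearestDist y x ∂μ := by
  refine csInf_le ⟨0, ?_⟩ ⟨voronoiCoupling μ y, voronoiCoupling_isProbabilityMeasure hy,
    voronoiCoupling_fst hy, voronoiCoupling_snd hy, (integral_voronoiCoupling hμ hy).symm⟩
  rintro _ ⟨π, -, -, -, rfl⟩
  exact integral_nonneg fun _ => abs_nonneg _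

lemma integral_nearestDist_le_W1 {μ ν : Measure ℝ} [IsProbabilityMeasure μ]
    [IsProbabilityMeasure ν] (hμ : Integrable id μ) {k : ℕ} [NeZero k] {y : Fin k → ℝ}
    (hν : ∀ᵐ t ∂ν, t ∈ Set.range y) :
    ∫ x, nearestDist y x ∂μ ≤ W1 μ ν := by
  refine le_csInf ⟨_, μ.prod ν, inferInstance, ?_, ?_, rfl⟩ ?_
  · simp [Measure.map_fst_prod]
  · simp [Measure.map_snd_prod]
  rintro _ ⟨π, hπ, h1, h2, rfl⟩
  have hsupp : ∀ᵐ p ∂π, p.2 ∈ Set.range y := by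
    rw [← h2] at hν
    exact ae_of_ae_map measurable_snd.aemeasurable hν
  have hi1 : Integrable (fun p : ℝ × ℝ => p.1) π := by
    rw [← h1] at hμ
    exact hμ.comp_measurable measurable_fst
  rw [← h1, integral_map measurable_fst.aemeasurable
    (nearestDist_lipschitz y).continuous.aestronglyMeasurable]
  refine integral_mono_ae ?_ ?_ ?_
  · rw [← h1] at hμ
    have : IsFiniteMeasure (π.map Prod.fst) := by rw [h1]; infer_instance
    exact (nearestDist_integrable hμ y).comp_measurable measurable_fst
  · refine (hi1.abs.add (integrable_const (∑ j, |y j|))).mono'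
      (Continuous.aestronglyMeasurable (by fun_prop)) ?_
    filter_upwards [hsupp] with p hp
    obtain ⟨j, hj⟩ := hp
    have := Finset.single_le_sum (f := fun j => |y j|) (fun i _ => abs_nonneg _)
      (Finset.mem_univ j)
    simp only [hj] at this
    rw [Real.norm_eq_abs, abs_abs]
    exact (abs_sub _ _).trans (add_le_add_right this _)
  · filter_upwards [hsupp] with p hp
    obtain ⟨j, hj⟩ := hp
    rw [← hj]
    exact nearestDist_le y p.1 j

lemma W1_voronoiMeasure {μ : Measure ℝ} [IsProbabilityMeasure μ] (hμ : Integrable id μ)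
    {k : ℕ} [NeZero k] {y : Fin k → ℝ} (hy : Monotone y) :
    W1 μ (voronoiMeasure μ y) = ∫ x, nearestDist y x ∂μ := by
  refine le_antisymm (W1_voronoiMeasure_le hμ hy) ?_
  have := (voronoiMeasure_mem_Pk (μ := μ) hy).1
  refine integral_nearestDist_le_W1 hμ ?_
  rw [ae_iff]
  simp [voronoiMeasure]

lemma projDist_le {μ : Measure ℝ} [IsProbabilityMeasure μ] (hμ : Integrable id μ)
    {k : ℕ} [NeZero k] (y : Fin k → ℝ) : projDist k μ ≤ ∫ x, nearestDist y x ∂μ := by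
  have hs : Monotone (y ∘ Tuple.sort y) := Tuple.monotone_sort y
  rw [← nearestDist_comp_perm y (Tuple.sort y), ← W1_voronoiMeasure hμ hs]
  refine csInf_le ⟨0, ?_⟩ ⟨_, voronoiMeasure_mem_Pk hs, rfl⟩
  rintro _ ⟨ν, -, rfl⟩
  exact W1_nonneg _ _

lemma le_projDist {μ : Measure ℝ} [IsProbabilityMeasure μ] (hμ : Integrable id μ)
    {k : ℕ} [NeZero k] {b : ℝ} (hb : ∀ y : Fin k → ℝ, b ≤ ∫ x, nearestDist y x ∂μ) :
    b ≤ projDist k μ := by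
  refine le_csInf ⟨_, _, voronoiMeasure_mem_Pk (μ := μ) (y := fun _ : Fin k => (0 : ℝ))
    monotone_const, rfl⟩ ?_
  rintro _ ⟨ν, ⟨hν, s, hs, hνs⟩, rfl⟩
  have hne : s.Nonempty := by
    rw [Finset.nonempty_iff_ne_empty]
    rintro rfl
    simp at hνs
  have hcard : 0 < s.card := hne.card_pos
  let y : Fin k → ℝ := fun j => s.equivFin.symm ⟨min j (s.card - 1), by omega⟩
  refine (hb y).trans (integral_nearestDist_le_W1 hμ ?_)
  rw [ae_iff]
  refine measure_mono_null (fun t ht => ?_) hνs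
  rw [Set.mem_compl_iff]
  refine fun hts => ht ?_
  replace hts : t ∈ s := hts
  refine ⟨⟨s.equivFin ⟨t, hts⟩, (s.equivFin ⟨t, hts⟩).2.trans_le hs⟩, ?_⟩
  have : min ((s.equivFin ⟨t, hts⟩ : Fin s.card) : ℕ) (s.card - 1) = s.equivFin ⟨t, hts⟩ := by
    have := (s.equivFin ⟨t, hts⟩).2
    omega
  simp [y, this]

/-- The signed indicator of the interval between `0` and `x`. -/
noncomputable def signedInterval (x t : ℝ) : ℝ :=
  (if 0 ≤ t then 1 else 0) - (if x ≤ t then 1 else 0)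

lemma signedInterval_of_nonneg {x : ℝ} (hx : 0 ≤ x) (t : ℝ) :
    signedInterval x t = (Set.Ico 0 x).indicator 1 t := by
  simp only [signedInterval, Set.indicator, Set.mem_Ico, Pi.one_apply]
  grind

lemma signedInterval_of_nonpos {x : ℝ} (hx : x ≤ 0) (t : ℝ) :
    signedInterval x t = -(Set.Ico x 0).indicator 1 t := by
  simp only [signedInterval, Set.indicator, Set.mem_Ico, Pi.one_apply]
  grind

lemma integrable_signedInterval (x : ℝ) : Integrable (signedInterval x) := by
  have (a b : ℝ) : Integrable ((Set.Ico a b).indicator (1 : ℝ → ℝ)) :=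
    (integrable_indicator_iff measurableSet_Ico).2 (integrableOn_const (by simp))
  rcases le_total 0 x with h | h
  · rw [funext (signedInterval_of_nonneg h)]
    exact this 0 x
  · rw [funext (signedInterval_of_nonpos h)]
    exact (this x 0).neg

lemma integral_abs_signedInterval (x : ℝ) : ∫ t, |signedInterval x t| = |x| := by
  have key (a b : ℝ) (hab : a ≤ b) :
      ∫ t, |(Set.Ico a b).indicator (1 : ℝ → ℝ) t| = b - a := by
    have : (fun t => |(Set.Ico a b).indicator (1 : ℝ → ℝ) t|) = (Set.Ico a b).indicator 1 := by
      funext t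
      exact abs_of_nonneg (Set.indicator_nonneg (fun _ _ => zero_le_one) t)
    rw [this, integral_indicator_one measurableSet_Ico, measureReal_def, Real.volume_Ico,
      ENNReal.toReal_ofReal (by linarith)]
  rcases le_total 0 x with h | h
  · simp_rw [signedInterval_of_nonneg h, key 0 x h, abs_of_nonneg h, sub_zero]
  · simp_rw [signedInterval_of_nonpos h, abs_neg, key x 0 h, abs_of_nonpos h, zero_sub]

lemma measurable_signedInterval : Measurable (Function.uncurry signedInterval) := by
  refine Measurable.sub ?_ ?_
  · exact Measurable.ite (measurableSet_le measurable_const measurable_snd) measurable_const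
      measurable_const
  · exact Measurable.ite (measurableSet_le measurable_fst measurable_snd) measurable_const
      measurable_const

lemma integral_deriv_mul_signedInterval {f : ℝ → ℝ} (hf : LipschitzWith 1 f) (x : ℝ) :
    ∫ t, deriv f t * signedInterval x t = f x - f 0 := by
  rw [← (hf.lipschitzOnWith (s := Set.uIcc 0 x)).absolutelyContinuousOnInterval.integral_deriv_eq_sub]
  rcases le_total 0 x with h | h
  · rw [intervalIntegral.integral_of_le h, ← integral_Ico_eq_integral_Ioc,
      ← integral_indicator measurableSet_Ico]
    refine integral_congr_ae (ae_of_all _ fun t => ?_)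
    simp only [signedInterval_of_nonneg h, Set.indicator, Pi.one_apply]
    split_ifs <;> simp
  · rw [intervalIntegral.integral_of_ge h, ← integral_Ico_eq_integral_Ioc,
      ← integral_indicator measurableSet_Ico, ← integral_neg]
    refine integral_congr_ae (ae_of_all _ fun t => ?_)
    simp only [signedInterval_of_nonpos h, Set.indicator, Pi.one_apply]
    split_ifs <;> simp

lemma integrable_signedInterval_prod {μ : Measure ℝ} [IsProbabilityMeasure μ]
    (hμ : Integrable id μ) : Integrable (Function.uncurry signedInterval) (μ.prod volume) := by
  rw [integrable_prod_iff measurable_signedInterval.aestronglyMeasurable]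
  refine ⟨ae_of_all _ integrable_signedInterval, ?_⟩
  simpa only [Function.uncurry, Real.norm_eq_abs, integral_abs_signedInterval, id] using hμ.abs

lemma integral_signedInterval (μ : Measure ℝ) [IsProbabilityMeasure μ] (t : ℝ) :
    ∫ x, signedInterval x t ∂μ = (if 0 ≤ t then 1 else 0) - μ.real (Set.Iic t) := by
  have h : (fun x : ℝ => if x ≤ t then (1 : ℝ) else 0) = (Set.Iic t).indicator 1 := by
    funext x; simp [Set.indicator]
  unfold signedInterval
  rw [integral_sub (integrable_const _), h, integral_indicator_one measurableSet_Iic]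
  · simp
  · rw [h]
    exact (integrable_indicator_iff measurableSet_Iic).2 (integrable_const _).integrableOn

lemma norm_deriv_le_one {f : ℝ → ℝ} (hf : LipschitzWith 1 f) (t : ℝ) : ‖deriv f t‖ ≤ 1 := by
  simpa using norm_deriv_le_of_lipschitz hf (x₀ := t)

lemma integral_sub_eq_integral_deriv_mul {f : ℝ → ℝ} (hf : LipschitzWith 1 f) {μ : Measure ℝ}
    [IsProbabilityMeasure μ] (hμ : Integrable id μ) :
    ∫ x, f x ∂μ - f 0 =
      ∫ t, deriv f t * ((if 0 ≤ t then 1 else 0) - μ.real (Set.Iic t)) := by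
  have hfi : Integrable f μ := by
    refine (hμ.abs.add (integrable_const |f 0|)).mono' hf.continuous.aestronglyMeasurable
      (ae_of_all _ fun x => ?_)
    have := hf.dist_le_mul x 0
    simp only [NNReal.coe_one, one_mul, Real.dist_eq, sub_zero] at this
    have h2 := abs_sub_abs_le_abs_sub (f x) (f 0)
    simp only [Real.norm_eq_abs, Pi.add_apply, id]
    linarith
  have hprod : Integrable (Function.uncurry fun x t => deriv f t * signedInterval x t)
      (μ.prod volume) := by
    refine (integrable_signedInterval_prod hμ).norm.mono'
      (((measurable_deriv f).comp measurable_snd).mul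
        measurable_signedInterval).aestronglyMeasurable (ae_of_all _ fun p => ?_)
    simp only [Function.uncurry, norm_mul]
    exact mul_le_of_le_one_left (norm_nonneg _) (norm_deriv_le_one hf _)
  have h1 : ∫ x, f x ∂μ - f 0 = ∫ x, (∫ t, deriv f t * signedInterval x t) ∂μ := by
    simp_rw [integral_deriv_mul_signedInterval hf]
    rw [integral_sub hfi (integrable_const _)]
    simp
  rw [h1, integral_integral_swap hprod]
  refine integral_congr_ae (ae_of_all _ fun t => ?_)
  simp only
  rw [integral_const_mul, integral_signedInterval]

lemma integrable_cdf_sub {μ : Measure ℝ} [IsProbabilityMeasure μ] (hμ : Integrable id μ) :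
    Integrable fun t : ℝ => (if 0 ≤ t then (1 : ℝ) else 0) - μ.real (Set.Iic t) := by
  simpa only [Function.uncurry, integral_signedInterval] using
    (integrable_signedInterval_prod hμ).integral_prod_right

/-- Kantorovich-type bound: integrals of a `1`-Lipschitz function differ by at most the
`L¹` distance of the distribution functions. -/
lemma ofReal_integral_sub_le {f : ℝ → ℝ} (hf : LipschitzWith 1 f) {μ ν : Measure ℝ}
    [IsProbabilityMeasure μ] [IsProbabilityMeasure ν] (hμ : Integrable id μ)
    (hν : Integrable id ν) :
    ENNReal.ofReal (∫ x, f x ∂μ - ∫ x, f x ∂ν) ≤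
      ∫⁻ t, ENNReal.ofReal |ν.real (Set.Iic t) - μ.real (Set.Iic t)| := by
  have hb {μ : Measure ℝ} [IsProbabilityMeasure μ] (hμ : Integrable id μ) : Integrable
      fun t : ℝ => deriv f t * ((if 0 ≤ t then (1 : ℝ) else 0) - μ.real (Set.Iic t)) :=
    (integrable_cdf_sub hμ).bdd_mul (c := 1) (measurable_deriv f).aestronglyMeasurable
      (ae_of_all _ (norm_deriv_le_one hf))
  have h : ∫ x, f x ∂μ - ∫ x, f x ∂ν =
      ∫ t, deriv f t * (ν.real (Set.Iic t) - μ.real (Set.Iic t)) := by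
    rw [← sub_sub_sub_cancel_right _ _ (f 0), integral_sub_eq_integral_deriv_mul hf hμ,
      integral_sub_eq_integral_deriv_mul hf hν, ← integral_sub (hb hμ) (hb hν)]
    refine integral_congr_ae (ae_of_all _ fun t => ?_)
    simp only
    ring
  rw [h]
  refine (ENNReal.ofReal_le_ofReal (Real.le_norm_self _)).trans ?_
  rw [ofReal_norm]
  refine (enorm_integral_le_lintegral_enorm _).trans (lintegral_mono fun t => ?_)
  rw [← ofReal_norm, norm_mul]
  exact ENNReal.ofReal_le_ofReal
    (mul_le_of_le_one_left (norm_nonneg _) (norm_deriv_le_one hf _))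

/-- Empirical distribution function. -/
noncomputable def empCdf {n : ℕ} (t : ℝ) (x : Fin n → ℝ) : ℝ :=
  (n : ℝ)⁻¹ * ∑ i, (Set.Iic t).indicator 1 (x i)

lemma empMeas_isProbabilityMeasure {n : ℕ} (hn : 0 < n) (x : Fin n → ℝ) :
    IsProbabilityMeasure (empMeas x) := by
  refine ⟨?_⟩
  simp only [empMeas, Measure.smul_apply, Measure.finsetSum_apply, measure_univ, smul_eq_mul,
    Finset.sum_const, Finset.card_univ, Fintype.card_fin, nsmul_eq_mul, mul_one]
  exact ENNReal.inv_mul_cancel (by simpa using hn.ne') (by simp)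

lemma integral_empMeas {n : ℕ} (x : Fin n → ℝ) (f : ℝ → ℝ) :
    ∫ t, f t ∂(empMeas x) = (n : ℝ)⁻¹ * ∑ i, f (x i) := by
  rw [empMeas, integral_smul_measure, integral_finsetSum_measure]
  · simp
  · exact fun i _ => integrable_dirac (by finiteness)

lemma integrable_empMeas {n : ℕ} (hn : 0 < n) (x : Fin n → ℝ) (f : ℝ → ℝ) :
    Integrable f (empMeas x) := by
  refine Integrable.smul_measure ?_ (by simpa using hn.ne')
  exact integrable_finsetSum_measure.2 fun i _ => integrable_dirac (by finiteness)

lemma empMeas_real_Iic {n : ℕ} (x : Fin n → ℝ) (t : ℝ) :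
    (empMeas x).real (Set.Iic t) = empCdf t x := by
  rw [← integral_indicator_one measurableSet_Iic, integral_empMeas]
  rfl

lemma measurable_empCdf {n : ℕ} :
    Measurable fun p : (Fin n → ℝ) × ℝ => empCdf p.2 p.1 := by
  unfold empCdf
  refine Measurable.const_mul (Finset.measurable_fun_sum _ fun i _ => ?_) _
  have : (fun p : (Fin n → ℝ) × ℝ => (Set.Iic p.2).indicator (1 : ℝ → ℝ) (p.1 i)) =
      fun p => if p.1 i ≤ p.2 then 1 else 0 := by
    funext p; simp [Set.indicator]
  rw [this]
  exact Measurable.ite (measurableSet_le (by fun_prop) measurable_snd) measurable_const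
    measurable_const

lemma measurable_empCdf_left {n : ℕ} (t : ℝ) :
    Measurable fun x : Fin n → ℝ => empCdf t x :=
  measurable_empCdf.comp (measurable_id.prodMk measurable_const)

lemma memLp_indicator_Iic (μ : Measure ℝ) [IsProbabilityMeasure μ] (t : ℝ) :
    MemLp ((Set.Iic t).indicator (1 : ℝ → ℝ)) 2 μ :=
  memLp_indicator_const 2 measurableSet_Iic 1 (Or.inr (by simp))

lemma variance_indicator_Iic (μ : Measure ℝ) [IsProbabilityMeasure μ] (t : ℝ) :
    ProbabilityTheory.variance ((Set.Iic t).indicator (1 : ℝ → ℝ)) μ =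
      μ.real (Set.Iic t) * (1 - μ.real (Set.Iic t)) := by
  rw [ProbabilityTheory.variance_eq_sub (memLp_indicator_Iic μ t)]
  have : ((Set.Iic t).indicator (1 : ℝ → ℝ)) ^ 2 = (Set.Iic t).indicator 1 := by
    funext x
    by_cases hx : x ∈ Set.Iic t <;> simp [hx]
  rw [this, integral_indicator_one measurableSet_Iic]
  ring

section
variable (μ : Measure ℝ) [IsProbabilityMeasure μ] {n : ℕ}

lemma memLp_empCdf (t : ℝ) :
    MemLp (fun x : Fin n → ℝ => empCdf t x) 2 (Measure.pi fun _ : Fin n => μ) := by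
  refine MemLp.const_mul ?_ _
  refine memLp_finsetSum _ fun i _ => ?_
  exact (memLp_indicator_Iic μ t).comp_measurePreserving (measurePreserving_eval _ i)

lemma integral_empCdf (hn : 0 < n) (t : ℝ) :
    ∫ x : Fin n → ℝ, empCdf t x ∂(Measure.pi fun _ : Fin n => μ) = μ.real (Set.Iic t) := by
  have hm := memLp_indicator_Iic μ t
  unfold empCdf
  rw [integral_const_mul, integral_finsetSum]
  · simp_rw [integral_comp_eval (μ := fun _ : Fin n => μ) hm.aestronglyMeasurable]
    simp only [integral_indicator_one measurableSet_Iic, Finset.sum_const, Finset.card_univ,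
      Fintype.card_fin, nsmul_eq_mul]
    field_simp
  · exact fun i _ => integrable_comp_eval (μ := fun _ : Fin n => μ) (hm.integrable one_le_two)

lemma variance_empCdf (hn : 0 < n) (t : ℝ) :
    ProbabilityTheory.variance (fun x : Fin n → ℝ => empCdf t x)
      (Measure.pi fun _ : Fin n => μ) =
      μ.real (Set.Iic t) * (1 - μ.real (Set.Iic t)) / n := by
  unfold empCdf
  rw [ProbabilityTheory.variance_const_mul]
  have := ProbabilityTheory.variance_sum_pi (μ := fun _ : Fin n => μ)
    (X := fun _ => (Set.Iic t).indicator (1 : ℝ → ℝ)) fun _ => memLp_indicator_Iic μ t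
  have e : (∑ i, fun x : Fin n → ℝ => (Set.Iic t).indicator (1 : ℝ → ℝ) (x i)) =
      fun x => ∑ i, (Set.Iic t).indicator (1 : ℝ → ℝ) (x i) := by
    funext x; simp
  rw [e] at this
  rw [this]
  simp only [variance_indicator_Iic, Finset.sum_const, Finset.card_univ, Fintype.card_fin,
    nsmul_eq_mul]
  field_simp

lemma lintegral_abs_empCdf_sub_le (hn : 0 < n) (t : ℝ) :
    ∫⁻ x : Fin n → ℝ, ENNReal.ofReal |empCdf t x - μ.real (Set.Iic t)|
        ∂(Measure.pi fun _ : Fin n => μ) ≤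
      ENNReal.ofReal (√(μ.real (Set.Iic t) * (1 - μ.real (Set.Iic t))) / √n) := by
  set P := Measure.pi fun _ : Fin n => μ
  have hZ : MemLp (fun x : Fin n → ℝ => empCdf t x - μ.real (Set.Iic t)) 2 P :=
    (memLp_empCdf μ t).sub (memLp_const _)
  have hvar := variance_empCdf μ hn t
  rw [ProbabilityTheory.variance_eq_integral (measurable_empCdf_left t).aemeasurable,
    integral_empCdf μ hn] at hvar
  have hnn := ProbabilityTheory.variance_nonneg
    |fun x : Fin n → ℝ => empCdf t x - μ.real (Set.Iic t)| P
  rw [ProbabilityTheory.variance_eq_sub hZ.abs] at hnn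
  simp only [Pi.pow_apply, Pi.abs_apply, sq_abs] at hnn
  rw [hvar] at hnn
  rw [← ofReal_integral_eq_lintegral_ofReal (hZ.integrable one_le_two).abs
    (ae_of_all _ fun _ => abs_nonneg _), ← Real.sqrt_div' _ (Nat.cast_nonneg _)]
  refine ENNReal.ofReal_le_ofReal (Real.le_sqrt_of_sq_le ?_)
  linarith

lemma lintegral_lintegral_abs_empCdf_sub_le (hn : 0 < n)
    (hK : Integrable fun t : ℝ => √(μ.real (Set.Iic t) * (1 - μ.real (Set.Iic t)))) :
    ∫⁻ x : Fin n → ℝ, (∫⁻ t, ENNReal.ofReal |empCdf t x - μ.real (Set.Iic t)|)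
        ∂(Measure.pi fun _ : Fin n => μ) ≤
      ENNReal.ofReal ((∫ t : ℝ, √(μ.real (Set.Iic t) * (1 - μ.real (Set.Iic t)))) / √n) := by
  have hF : Measurable fun t : ℝ => μ.real (Set.Iic t) :=
    Monotone.measurable fun a b hab => measureReal_mono (Set.Iic_subset_Iic.2 hab)
  rw [lintegral_lintegral_swap]
  · refine (lintegral_mono fun t => lintegral_abs_empCdf_sub_le μ hn t).trans ?_
    rw [← integral_div, ofReal_integral_eq_lintegral_ofReal (hK.div_const _)]
    exact ae_of_all _ fun t => by positivity
  · refine Measurable.aemeasurable ?_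
    exact ((measurable_empCdf.sub (hF.comp measurable_snd)).abs).ennreal_ofReal

/-- Chebyshev's inequality for the empirical distribution function. -/
lemma measure_le_abs_empCdf_sub (hn : 0 < n) (t : ℝ) {d : ℝ} (hd : 0 < d) :
    (Measure.pi fun _ : Fin n => μ) {x | d ≤ |empCdf t x - μ.real (Set.Iic t)|} ≤
      ENNReal.ofReal (μ.real (Set.Iic t) * (1 - μ.real (Set.Iic t)) / n / d ^ 2) := by
  have := ProbabilityTheory.meas_ge_le_variance_div_sq (memLp_empCdf μ (n := n) t) hd
  rwa [integral_empCdf μ hn, variance_empCdf μ hn] at this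
end

lemma integrable_one_add_abs_rpow {μ : Measure ℝ} [IsProbabilityMeasure μ] {r : ℝ} (hr : 0 < r)
    (h : Integrable (fun x : ℝ => |x| ^ r) μ) : Integrable (fun x : ℝ => (1 + |x|) ^ r) μ := by
  refine (((integrable_const (1 : ℝ)).add h).const_mul (2 ^ r)).mono'
    (measurable_const.add measurable_norm |>.pow_const r).aestronglyMeasurable
    (ae_of_all _ fun x => ?_)
  rw [Real.norm_of_nonneg (by positivity), Pi.add_apply]
  have hx := abs_nonneg x
  have hx' : 0 ≤ |x| ^ r := by positivity
  rcases le_total |x| 1 with h1 | h1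
  · calc (1 + |x|) ^ r ≤ 2 ^ r := Real.rpow_le_rpow (by positivity) (by linarith) hr.le
      _ ≤ 2 ^ r * (1 + |x| ^ r) := le_mul_of_one_le_right (by positivity) (by linarith)
  · calc (1 + |x|) ^ r ≤ (2 * |x|) ^ r := Real.rpow_le_rpow (by positivity) (by linarith) hr.le
      _ = 2 ^ r * |x| ^ r := Real.mul_rpow (by positivity) hx
      _ ≤ 2 ^ r * (1 + |x| ^ r) := by gcongr; linarith

lemma cdf_mul_one_sub_le {μ : Measure ℝ} [IsProbabilityMeasure μ] {r : ℝ} (hr : 0 < r)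
    (h : Integrable (fun x : ℝ => (1 + |x|) ^ r) μ) (t : ℝ) :
    μ.real (Set.Iic t) * (1 - μ.real (Set.Iic t)) ≤
      (∫ x, (1 + |x|) ^ r ∂μ) / (1 + |t|) ^ r := by
  have hpos : 0 < (1 + |t|) ^ r := by positivity
  have hmarkov := mul_meas_ge_le_integral_of_nonneg
    (ae_of_all μ fun x : ℝ => (by positivity : 0 ≤ (1 + |x|) ^ r)) h ((1 + |t|) ^ r)
  have hle : μ.real {x | (1 + |t|) ^ r ≤ (1 + |x|) ^ r} ≤
      (∫ x, (1 + |x|) ^ r ∂μ) / (1 + |t|) ^ r := by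
    rw [le_div_iff₀' hpos]
    exact hmarkov
  have h0 : 0 ≤ μ.real (Set.Iic t) := measureReal_nonneg
  have h1 : μ.real (Set.Iic t) ≤ 1 := measureReal_le_one
  have hsub : ∀ x : ℝ, |t| ≤ |x| → (1 + |t|) ^ r ≤ (1 + |x|) ^ r := fun x hx =>
    Real.rpow_le_rpow (by positivity) (by linarith) hr.le
  rcases le_total 0 t with ht | ht
  · have : 1 - μ.real (Set.Iic t) ≤ μ.real {x | (1 + |t|) ^ r ≤ (1 + |x|) ^ r} := by
      rw [← probReal_compl_eq_one_sub measurableSet_Iic]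
      refine measureReal_mono fun x hx => hsub x ?_
      simp only [Set.mem_compl_iff, Set.mem_Iic, not_le] at hx
      exact abs_le_abs_of_nonneg ht hx.le
    nlinarith
  · have : μ.real (Set.Iic t) ≤ μ.real {x | (1 + |t|) ^ r ≤ (1 + |x|) ^ r} := by
      refine measureReal_mono fun x hx => hsub x ?_
      exact abs_le_abs_of_nonpos ht hx
    nlinarith

lemma integrable_sqrt_cdf {μ : Measure ℝ} [IsProbabilityMeasure μ] {δ : ℝ} (hδ : 0 < δ)
    (h : Integrable (fun x : ℝ => (1 + |x|) ^ (2 + δ)) μ) :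
    Integrable fun t : ℝ => √(μ.real (Set.Iic t) * (1 - μ.real (Set.Iic t))) := by
  have hF : Measurable fun t : ℝ => μ.real (Set.Iic t) :=
    Monotone.measurable fun a b hab => measureReal_mono (Set.Iic_subset_Iic.2 hab)
  have hi : Integrable fun t : ℝ => (1 + ‖t‖) ^ (-(1 + δ / 2)) :=
    integrable_one_add_norm (by simp; linarith)
  refine (hi.const_mul (√(∫ x, (1 + |x|) ^ (2 + δ) ∂μ))).mono'
    (hF.mul (measurable_const.sub hF)).sqrt.aestronglyMeasurable (ae_of_all _ fun t => ?_)
  rw [Real.norm_of_nonneg (Real.sqrt_nonneg _)]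
  refine (Real.sqrt_le_sqrt (cdf_mul_one_sub_le (by linarith) h t)).trans (le_of_eq ?_)
  rw [Real.sqrt_div' _ (by positivity), div_eq_mul_inv, Real.sqrt_eq_rpow ((1 + |t|) ^ (2 + δ)),
    ← Real.rpow_mul (by positivity), Real.norm_eq_abs, Real.rpow_neg (by positivity)]
  congr 3
  ring

lemma cdf_mul_one_sub_le_sq {μ : Measure ℝ} [IsProbabilityMeasure μ] {r : ℝ} (hr : 2 ≤ r)
    (h : Integrable (fun x : ℝ => (1 + |x|) ^ r) μ) (q : ℝ) {s t : ℝ} (hs : 0 < s)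
    (hst : s ≤ |t - q|) :
    μ.real (Set.Iic t) * (1 - μ.real (Set.Iic t)) ≤
      (∫ x, (1 + |x|) ^ r ∂μ) * (1 + |q|) ^ 2 / s ^ 2 := by
  have hM : 0 ≤ ∫ x, (1 + |x|) ^ r ∂μ := integral_nonneg fun x => by positivity
  refine (cdf_mul_one_sub_le (by linarith) h t).trans ?_
  have h1 : (1 + |t|) ^ 2 ≤ (1 + |t|) ^ r := by
    rw [← Real.rpow_two]
    exact Real.rpow_le_rpow_of_exponent_le (by linarith [abs_nonneg t]) hr
  refine (div_le_div_of_nonneg_left hM (by positivity) h1).trans ?_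
  rw [div_le_div_iff₀ (by positivity) (by positivity), mul_assoc, ← mul_pow]
  refine mul_le_mul_of_nonneg_left (pow_le_pow_left₀ hs.le ?_ 2) hM
  have := abs_sub t q
  nlinarith [abs_nonneg t, abs_nonneg q]

lemma lintegral_ofReal_le_of_tail {Ω : Type*} [MeasurableSpace Ω] {P : Measure Ω}
    [IsProbabilityMeasure P] {Z : Ω → ℝ} (hZ : Measurable Z) (hZ0 : 0 ≤ Z) {a B : ℝ}
    (ha : 0 < a) (hB : 0 ≤ B)
    (htail : ∀ s, a < s → P {ω | s < Z ω} ≤ ENNReal.ofReal (B / s ^ 2)) :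
    ∫⁻ ω, ENNReal.ofReal (Z ω) ∂P ≤ ENNReal.ofReal (a + B / a) := by
  rw [lintegral_eq_lintegral_meas_lt P (ae_of_all _ hZ0) hZ.aemeasurable,
    ← Set.Ioc_union_Ioi_eq_Ioi ha.le,
    lintegral_union measurableSet_Ioi (Set.Ioc_disjoint_Ioi le_rfl),
    ENNReal.ofReal_add ha.le (by positivity)]
  refine add_le_add ?_ ?_
  · refine (setLIntegral_mono measurable_const fun s _ => prob_le_one).trans ?_
    simp
  · have hmono : ∫⁻ s in Set.Ioi a, P {ω | s < Z ω} ≤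
        ∫⁻ s in Set.Ioi a, ENNReal.ofReal (B / s ^ 2) :=
      setLIntegral_mono (by fun_prop) fun s hs => htail s hs
    refine hmono.trans ?_
    have e : ∀ s ∈ Set.Ioi a, B / s ^ 2 = B * s ^ (-2 : ℝ) := by
      intro s hs
      rw [Real.rpow_neg (ha.trans hs).le, Real.rpow_two, div_eq_mul_inv]
    have hpow : IntegrableOn (fun s : ℝ => B * s ^ (-2 : ℝ)) (Set.Ioi a) :=
      (integrableOn_Ioi_rpow_of_lt (by norm_num) ha).const_mul B
    rw [← ofReal_integral_eq_lintegral_ofReal]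
    · refine ENNReal.ofReal_le_ofReal (le_of_eq ?_)
      rw [setIntegral_congr_fun measurableSet_Ioi e, integral_const_mul,
        integral_Ioi_rpow_of_lt (by norm_num) ha]
      have : (-2 : ℝ) + 1 = -1 := by norm_num
      rw [this, Real.rpow_neg_one, neg_div_neg_eq, div_one, div_eq_mul_inv]
    · exact hpow.congr_fun (fun s hs => (e s hs).symm) measurableSet_Ioi
    · exact ae_of_all _ fun s => by positivity

lemma nat_mul_empCdf {n : ℕ} (hn : 0 < n) (t : ℝ) (x : Fin n → ℝ) :
    n * empCdf t x = ((Finset.univ.filter fun i => x i ≤ t).card : ℝ) := by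
  unfold empCdf
  rw [mul_inv_cancel_left₀ (by positivity), Finset.card_filter]
  push_cast
  refine Finset.sum_congr rfl fun i _ => ?_
  simp [Set.indicator]

lemma percentileMech_le_iff {k n : ℕ} (hn : 0 < n) (v : Fin k → ℝ) (x : Fin n → ℝ) (j : Fin k)
    (t : ℝ) : percentileMech v x j ≤ t ↔
      ((min ⌊((n : ℝ) - 1) * v j⌋₊ (n - 1) : ℕ) : ℝ) < n * empCdf t x := by
  have hsort : Monotone (x ∘ Tuple.sort x) := Tuple.monotone_sort x
  have hcard : (Finset.univ.filter fun i => (x ∘ Tuple.sort x) i ≤ t).card =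
      (Finset.univ.filter fun i => x i ≤ t).card :=
    Finset.card_equiv (Tuple.sort x) fun i => by simp
  rw [nat_mul_empCdf hn, Nat.cast_lt, ← hcard]
  simp only [percentileMech, hn, dite_true]
  exact (Tuple.lt_card_le_iff_apply_le_of_monotone
    (j := ⟨min ⌊((n : ℝ) - 1) * v j⌋₊ (n - 1), by omega⟩) hsort).symm

lemma measurable_percentileMech {k n : ℕ} (hn : 0 < n) (v : Fin k → ℝ) (j : Fin k) :
    Measurable fun x : Fin n → ℝ => percentileMech v x j := by
  refine measurable_of_Iic fun t => ?_
  have : (fun x : Fin n → ℝ => percentileMech v x j) ⁻¹' Set.Iic t =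
      {x | ((min ⌊((n : ℝ) - 1) * v j⌋₊ (n - 1) : ℕ) : ℝ) < n * empCdf t x} := by
    ext x
    exact percentileMech_le_iff hn v x j t
  rw [this]
  exact measurableSet_lt measurable_const ((measurable_empCdf_left t).const_mul _)

lemma percentile_rank_bounds {n : ℕ} (hn : 0 < n) {u : ℝ} (hu : u ∈ Set.Ioo (0 : ℝ) 1) :
    ((min ⌊((n : ℝ) - 1) * u⌋₊ (n - 1) : ℕ) : ℝ) ≤ n * u ∧
      n * u - 2 < ((min ⌊((n : ℝ) - 1) * u⌋₊ (n - 1) : ℕ) : ℝ) := by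
  have h1 : (1 : ℝ) ≤ n := by exact_mod_cast hn
  have hn1 : ((n - 1 : ℕ) : ℝ) = n - 1 := by rw [Nat.cast_sub hn]; simp
  have hfl : (⌊((n : ℝ) - 1) * u⌋₊ : ℝ) ≤ ((n : ℝ) - 1) * u :=
    Nat.floor_le (mul_nonneg (by linarith) hu.1.le)
  have hfl2 := Nat.lt_floor_add_one (((n : ℝ) - 1) * u)
  rw [Nat.cast_min, hn1]
  obtain ⟨hu0, hu1⟩ := hu
  constructor
  · exact (min_le_left _ _).trans (by nlinarith)
  · rw [lt_min_iff]; constructor <;> nlinarith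

/-- If the distribution function grows at least linearly near `q`, the percentile mechanism is
within `O(n^{-1/2})` of `q` on average. -/
lemma lintegral_percentileMech_sub_le {μ : Measure ℝ} [IsProbabilityMeasure μ] {r : ℝ}
    (hr : 2 ≤ r) (h : Integrable (fun x : ℝ => (1 + |x|) ^ r) μ) {k : ℕ} (v : Fin k → ℝ)
    (j : Fin k) (hv : v j ∈ Set.Ioo (0 : ℝ) 1) {q c ε : ℝ} (hc : 0 < c) (hε : 0 < ε)
    (hgrow : ∀ s, 0 < s → v j + c * min s ε ≤ μ.real (Set.Iic (q + s)) ∧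
      μ.real (Set.Iic (q - s)) ≤ v j - c * min s ε) :
    ∃ C N : ℝ, ∀ n : ℕ, 0 < n → N ≤ n →
      ∫⁻ x : Fin n → ℝ, ENNReal.ofReal |percentileMech v x j - q|
        ∂(Measure.pi fun _ : Fin n => μ) ≤ ENNReal.ofReal (C / √n) := by
  set V := (∫ x, (1 + |x|) ^ r ∂μ) * (1 + |q|) ^ 2 with hV
  have hV0 : 0 ≤ V := mul_nonneg (integral_nonneg fun x => by positivity) (by positivity)
  set L := 4 * (1 + V / ε ^ 2) / c ^ 2 with hL
  refine ⟨4 / c + 2 * L / (4 / c), 4 / (c * ε), fun n hn hN => ?_⟩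
  have hn' : (1 : ℝ) ≤ n := by exact_mod_cast hn
  have hsn : 0 < √(n : ℝ) := by positivity
  have hss : √(n : ℝ) * √n = n := Real.mul_self_sqrt (by positivity)
  have hsn1 : √(n : ℝ) ≤ n := by nlinarith [Real.one_le_sqrt.2 hn']
  set a := 4 / c / √n with ha
  have ha0 : 0 < a := by positivity
  have htail : ∀ s, a < s → (Measure.pi fun _ : Fin n => μ)
      {x : Fin n → ℝ | s < |percentileMech v x j - q|} ≤ ENNReal.ofReal (2 * L / n / s ^ 2) := by
    intro s hs
    have hs0 : 0 < s := ha0.trans hs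
    set d := c / 2 * min s ε with hd
    have hm : 0 < min s ε := lt_min hs0 hε
    have hd0 : 0 < d := by positivity
    have hcn : 2 / n ≤ d := by
      have h1 : 4 / c / n ≤ s := (div_le_div_of_nonneg_left (by positivity) hsn hsn1).trans hs.le
      have h2 : 4 / c / n ≤ ε := by
        rw [div_le_iff₀ (by positivity)] at hN ⊢
        rw [div_le_iff₀ hc]
        linarith
      have h3 : 4 / c / n ≤ min s ε := le_min h1 h2
      calc 2 / (n : ℝ) = c / 2 * (4 / c / n) := by field_simp; norm_num
        _ ≤ d := mul_le_mul_of_nonneg_left h3 (by positivity)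
    obtain ⟨hg1, hg2⟩ := hgrow s hs0
    obtain ⟨hr1, hr2⟩ := percentile_rank_bounds hn hv
    have hsub : {x : Fin n → ℝ | s < |percentileMech v x j - q|} ⊆
        {x | d ≤ |empCdf (q + s) x - μ.real (Set.Iic (q + s))|} ∪
        {x | d ≤ |empCdf (q - s) x - μ.real (Set.Iic (q - s))|} := by
      intro x hx
      rcases lt_abs.1 (show s < |percentileMech v x j - q| from hx) with hx | hx
      · left
        have h1 : ¬ percentileMech v x j ≤ q + s := by linarith
        rw [percentileMech_le_iff hn, not_lt] at h1
        have h2 : empCdf (q + s) x ≤ v j := by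
          refine le_of_mul_le_mul_left (h1.trans hr1) (by positivity)
        rw [Set.mem_ofPred_eq, abs_sub_comm]
        refine le_trans ?_ (le_abs_self _)
        have : 0 < c * min s ε := by positivity
        linarith
      · right
        have h1 : percentileMech v x j ≤ q - s := by linarith
        rw [percentileMech_le_iff hn] at h1
        have h2 : v j - 2 / n < empCdf (q - s) x := by
          refine lt_of_mul_lt_mul_left ?_ (show (0 : ℝ) ≤ n by positivity)
          rw [mul_sub, mul_div_cancel₀ _ (by positivity)]
          linarith
        rw [Set.mem_ofPred_eq]
        refine le_trans ?_ (le_abs_self _)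
        have : c * min s ε = d + d := by rw [hd]; ring
        linarith
    have hbound : ∀ t, s ≤ |t - q| →
        μ.real (Set.Iic t) * (1 - μ.real (Set.Iic t)) / n / d ^ 2 ≤ L / n / s ^ 2 := by
      intro t ht
      have h0 : 0 ≤ μ.real (Set.Iic t) := measureReal_nonneg
      have h1 : μ.real (Set.Iic t) ≤ 1 := measureReal_le_one
      have hV' := cdf_mul_one_sub_le_sq hr h q hs0 ht
      rw [← hV] at hV'
      have hp1 : μ.real (Set.Iic t) * (1 - μ.real (Set.Iic t)) ≤ 1 := by nlinarith
      set w := μ.real (Set.Iic t) * (1 - μ.real (Set.Iic t)) with hw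
      have key : w / d ^ 2 ≤ L / s ^ 2 := by
        rw [div_le_div_iff₀ (by positivity) (by positivity)]
        have hLd : L * d ^ 2 = (1 + V / ε ^ 2) * (min s ε) ^ 2 := by
          rw [hL, hd]; field_simp; norm_num
        rw [hLd]
        rcases le_total s ε with hse | hse
        · rw [min_eq_left hse]
          have : 0 ≤ V / ε ^ 2 := by positivity
          nlinarith [sq_nonneg s]
        · rw [min_eq_right hse]
          have h3 : w * s ^ 2 ≤ V := by rwa [le_div_iff₀ (by positivity)] at hV'
          have h4 : (1 + V / ε ^ 2) * ε ^ 2 = ε ^ 2 + V := by field_simp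
          rw [h4]
          nlinarith [sq_nonneg ε]
      calc w / n / d ^ 2 = w / d ^ 2 / n := by ring
        _ ≤ L / s ^ 2 / n := by gcongr
        _ = L / n / s ^ 2 := by ring
    refine (measure_mono hsub).trans ((measure_union_le _ _).trans ?_)
    have e : 2 * L / n / s ^ 2 = L / n / s ^ 2 + L / n / s ^ 2 := by ring
    rw [e, ENNReal.ofReal_add (by positivity) (by positivity)]
    refine add_le_add ?_ ?_
    · refine (measure_le_abs_empCdf_sub μ hn _ hd0).trans (ENNReal.ofReal_le_ofReal ?_)
      exact hbound _ (by simp [le_abs_self])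
    · refine (measure_le_abs_empCdf_sub μ hn _ hd0).trans (ENNReal.ofReal_le_ofReal ?_)
      exact hbound _ (by simp [le_abs_self])
  refine (lintegral_ofReal_le_of_tail
    ((measurable_percentileMech hn v j).sub_const q).abs (fun _ => abs_nonneg _) ha0
    (by positivity) htail).trans (le_of_eq ?_)
  congr 1
  rw [add_div, ← ha]
  congr 1
  rw [ha]
  nth_rewrite 1 [← hss]
  field_simp

lemma mcdf_eq_cdf (μ : Measure ℝ) [IsProbabilityMeasure μ] (t : ℝ) :
    mcdf μ t = ProbabilityTheory.cdf μ t := (ProbabilityTheory.cdf_eq_real μ t).symm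

section quantile
variable {μ : Measure ℝ} [IsProbabilityMeasure μ] {u : ℝ}

lemma quantileSet_nonempty (hu : u < 1) : {t : ℝ | u ≤ mcdf μ t}.Nonempty := by
  obtain ⟨t, ht⟩ := ((ProbabilityTheory.tendsto_cdf_atTop μ).eventually (lt_mem_nhds hu)).exists
  exact ⟨t, by rw [Set.mem_ofPred_eq, mcdf_eq_cdf]; exact ht.le⟩

lemma quantileSet_bddBelow (hu : 0 < u) : BddBelow {t : ℝ | u ≤ mcdf μ t} := by
  obtain ⟨t, ht⟩ := ((ProbabilityTheory.tendsto_cdf_atBot μ).eventually (gt_mem_nhds hu)).exists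
  refine ⟨t, fun s hs => ?_⟩
  rw [Set.mem_ofPred_eq, mcdf_eq_cdf] at hs
  by_contra! h
  linarith [ProbabilityTheory.monotone_cdf μ h.le]

lemma mquantile_mono {w : ℝ} (hu : 0 < u) (huw : u ≤ w) (hw : w < 1) :
    mquantile μ u ≤ mquantile μ w :=
  csInf_le_csInf (quantileSet_bddBelow hu) (quantileSet_nonempty hw) fun _ ht => huw.trans ht

lemma cdf_lt_of_lt_mquantile (hu : 0 < u) {t : ℝ} (ht : t < mquantile μ u) :
    ProbabilityTheory.cdf μ t < u := by
  rw [← mcdf_eq_cdf]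
  by_contra! h
  exact absurd (csInf_le (quantileSet_bddBelow hu) h) (not_le.2 ht)

lemma le_cdf_mquantile (hu1 : u < 1) :
    u ≤ ProbabilityTheory.cdf μ (mquantile μ u) := by
  have hc := ((ProbabilityTheory.cdf μ).right_continuous (mquantile μ u)).mono Set.Ioi_subset_Ici_self
  refine ge_of_tendsto hc ?_
  filter_upwards [self_mem_nhdsWithin] with t ht
  obtain ⟨s, hs, hst⟩ := exists_lt_of_csInf_lt (quantileSet_nonempty (μ := μ) hu1) ht
  rw [Set.mem_ofPred_eq, mcdf_eq_cdf] at hs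
  exact hs.trans (ProbabilityTheory.monotone_cdf μ hst.le)

lemma measure_Iio_mquantile_le (hu : 0 < u) : μ (Set.Iio (mquantile μ u)) ≤ ENNReal.ofReal u := by
  rw [← ProbabilityTheory.measure_cdf μ, StieltjesFunction.measure_Iio _
    (ProbabilityTheory.tendsto_cdf_atBot μ), sub_zero, ProbabilityTheory.measure_cdf μ]
  refine ENNReal.ofReal_le_ofReal ?_
  refine le_of_tendsto ((ProbabilityTheory.monotone_cdf μ).tendsto_leftLim _) ?_
  filter_upwards [self_mem_nhdsWithin] with t ht
  exact (cdf_lt_of_lt_mquantile hu ht).le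

lemma cdf_mquantile (hμ : ∀ x : ℝ, μ {x} = 0) (hu : u ∈ Set.Ioo (0 : ℝ) 1) :
    ProbabilityTheory.cdf μ (mquantile μ u) = u := by
  refine le_antisymm ?_ (le_cdf_mquantile hu.2)
  have h : μ (Set.Iic (mquantile μ u)) ≤ ENNReal.ofReal u := by
    rw [← Set.Iio_union_right]
    refine (measure_union_le _ _).trans ?_
    rw [hμ, add_zero]
    exact measure_Iio_mquantile_le hu.1
  rw [ProbabilityTheory.cdf_eq_real]
  exact ENNReal.toReal_le_of_le_ofReal hu.1.le h
end quantile

/-- Under the basic assumptions the distribution function grows at least linearly around its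
interior quantiles. -/
lemma exists_linear_growth {μ : Measure ℝ} (hμ : BasicAssumptions μ) {u : ℝ}
    (hu : u ∈ Set.Ioo (0 : ℝ) 1) :
    ∃ c ε : ℝ, 0 < c ∧ 0 < ε ∧ ∀ s, 0 < s →
      u + c * min s ε ≤ μ.real (Set.Iic (mquantile μ u + s)) ∧
      μ.real (Set.Iic (mquantile μ u - s)) ≤ u - c * min s ε := by
  obtain ⟨hprob, ρ, S, hρ, -, hS, hSc, hpos, -, hdiff⟩ := hμ
  have hatom : ∀ x : ℝ, μ {x} = 0 := fun x => by
    rw [hρ]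
    exact withDensity_absolutelyContinuous _ _ (measure_singleton x)
  have hFq := cdf_mquantile hatom hu
  set q := mquantile μ u with hq
  rw [ProbabilityTheory.cdf_eq_real] at hFq
  have hmeet : ∀ A : Set ℝ, μ A ≠ 0 → (A ∩ S).Nonempty := by
    intro A hA
    by_contra! h
    exact hA (measure_mono_null (fun x hx hxS => Set.eq_empty_iff_forall_notMem.1 h x ⟨hx, hxS⟩) hSc)
  obtain ⟨a, haq, haS⟩ := hmeet (Set.Iio q) (by
    intro h0
    have : μ (Set.Iic q) = 0 := by
      rw [← Set.Iio_union_right]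
      exact measure_union_null h0 (hatom q)
    rw [measureReal_def, this, ENNReal.toReal_zero] at hFq
    exact hu.1.ne hFq)
  obtain ⟨b, hqb, hbS⟩ := hmeet (Set.Ioi q) (by
    intro h0
    have h1 : μ.real (Set.Iic q)ᶜ = 0 := by
      rw [Set.compl_Iic, measureReal_def, h0, ENNReal.toReal_zero]
    rw [probReal_compl_eq_one_sub measurableSet_Iic] at h1
    linarith [hu.2])
  have hq_mem : q ∈ interior S :=
    interior_mono (hS.out haS hbS) (interior_mono Set.Ioo_subset_Icc_self
      (by rw [interior_Ioo]; exact ⟨haq, hqb⟩))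
  have hcont : ContinuousAt ρ q :=
    (hdiff q (interior_subset hq_mem)).continuousWithinAt.continuousAt
      (mem_interior_iff_mem_nhds.1 hq_mem)
  have hρq := hpos q hq_mem
  obtain ⟨ε, hε, hball⟩ := Metric.eventually_nhds_iff.1
    (hcont.eventually (lt_mem_nhds (half_lt_self hρq)))
  have hdens : ∀ x y, q - ε / 2 ≤ x → x ≤ y → y ≤ q + ε / 2 →
      μ.real (Set.Iic x) + ρ q / 2 * (y - x) ≤ μ.real (Set.Iic y) := by
    intro x y hx hxy hy
    have h1 : ENNReal.ofReal (ρ q / 2 * (y - x)) ≤ μ (Set.Ioc x y) := by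
      rw [hρ, withDensity_apply _ measurableSet_Ioc, ENNReal.ofReal_mul (by positivity),
        ← Real.volume_Ioc, ← setLIntegral_const]
      refine setLIntegral_mono' measurableSet_Ioc fun t ht => ENNReal.ofReal_le_ofReal ?_
      refine (hball ?_).le
      rw [Real.dist_eq, abs_lt]
      constructor <;> linarith [ht.1, ht.2]
    have h2 : ρ q / 2 * (y - x) ≤ μ.real (Set.Ioc x y) :=
      (ENNReal.ofReal_le_iff_le_toReal (by finiteness)).1 h1
    rw [← Set.Iic_union_Ioc_eq_Iic hxy, measureReal_union (Set.Iic_disjoint_Ioc le_rfl)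
      measurableSet_Ioc]
    linarith
  refine ⟨ρ q / 2, ε / 2, by positivity, by positivity, fun s hs => ⟨?_, ?_⟩⟩
  · have hm : 0 < min s (ε / 2) := lt_min hs (by positivity)
    have h1 := hdens q (q + min s (ε / 2)) (by linarith) (by linarith)
      (by linarith [min_le_right s (ε / 2)])
    have h2 : μ.real (Set.Iic (q + min s (ε / 2))) ≤ μ.real (Set.Iic (q + s)) :=
      measureReal_mono (Set.Iic_subset_Iic.2 (by linarith [min_le_left s (ε / 2)]))
    rw [add_sub_cancel_left] at h1
    linarith
  · have hm : 0 < min s (ε / 2) := lt_min hs (by positivity)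
    have h1 := hdens (q - min s (ε / 2)) q (by linarith [min_le_right s (ε / 2)]) (by linarith)
      (by linarith)
    have h2 : μ.real (Set.Iic (q - s)) ≤ μ.real (Set.Iic (q - min s (ε / 2))) :=
      measureReal_mono (Set.Iic_subset_Iic.2 (by linarith [min_le_left s (ε / 2)]))
    rw [_root_.sub_sub_cancel] at h1
    linarith

lemma exists_pos_le_integral_nearestDist {μ : Measure ℝ} (hμ : BasicAssumptions μ)
    (hi : Integrable id μ) (k : ℕ) [NeZero k] :
    ∃ b : ℝ, 0 < b ∧ ∀ y : Fin k → ℝ, b ≤ ∫ x, nearestDist y x ∂μ := by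
  obtain ⟨hprob, ρ, -, hρ, -⟩ := hμ
  have hfin : ∫⁻ x, ENNReal.ofReal (ρ x) ≠ ∞ := by
    have : μ Set.univ = 1 := measure_univ
    rw [hρ, withDensity_apply _ MeasurableSet.univ, setLIntegral_univ] at this
    simp [this]
  obtain ⟨δ, hδ, hsmall⟩ := exists_pos_setLIntegral_lt_of_measure_lt hfin
    (ε := ENNReal.ofReal (1 / 2)) (by simp)
  have hlim : Tendsto (fun r : ℝ => (k : ℝ≥0∞) * ENNReal.ofReal (2 * r)) (𝓝[>] 0) (𝓝 0) := by
    have hc : Continuous fun r : ℝ => (k : ℝ≥0∞) * ENNReal.ofReal (2 * r) :=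
      (ENNReal.continuous_const_mul (by finiteness)).comp
        (ENNReal.continuous_ofReal.comp (by fun_prop))
    simpa using (hc.tendsto 0).mono_left nhdsWithin_le_nhds
  obtain ⟨r, hr, hr0⟩ := ((hlim.eventually (gt_mem_nhds hδ)).and self_mem_nhdsWithin).exists
  have hr0 : 0 < r := hr0
  refine ⟨r * (1 / 2), by positivity, fun y => ?_⟩
  have hmeas : MeasurableSet {t | r ≤ nearestDist y t} :=
    measurableSet_le measurable_const (nearestDist_lipschitz y).continuous.measurable
  have hvol : volume {t | r ≤ nearestDist y t}ᶜ < δ := by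
    refine lt_of_le_of_lt ?_ hr
    have hsub : {t | r ≤ nearestDist y t}ᶜ ⊆ ⋃ j, Set.Ioo (y j - r) (y j + r) := by
      intro t ht
      rw [Set.mem_compl_iff, Set.mem_ofPred_eq, not_le] at ht
      obtain ⟨j, hj⟩ := exists_lt_of_ciInf_lt ht
      rw [abs_lt] at hj
      exact Set.mem_iUnion.2 ⟨j, by linarith [hj.1], by linarith [hj.2]⟩
    refine (measure_mono hsub).trans ((measure_iUnion_fintype_le _ _).trans (le_of_eq ?_))
    have e : ∀ j, y j + r - (y j - r) = 2 * r := fun j => by ring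
    simp [Real.volume_Ioo, e]
  have hμA := hsmall _ hvol
  rw [← withDensity_apply _ hmeas.compl, ← hρ] at hμA
  have hA : μ.real {t | r ≤ nearestDist y t}ᶜ ≤ 1 / 2 :=
    ENNReal.toReal_le_of_le_ofReal (by norm_num) hμA.le
  rw [probReal_compl_eq_one_sub hmeas] at hA
  refine le_trans ?_ (mul_meas_ge_le_integral_of_nonneg
    (ae_of_all μ (nearestDist_nonneg y)) (nearestDist_integrable hi y) r)
  gcongr
  linarith

lemma integrable_and_integral_le_of_lintegral_le {α : Type*} [MeasurableSpace α] {P : Measure α}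
    {f : α → ℝ} (hf : AEStronglyMeasurable f P) (h0 : ∀ x, 0 ≤ f x) {b : ℝ} (hb : 0 ≤ b)
    (h : ∫⁻ x, ENNReal.ofReal (f x) ∂P ≤ ENNReal.ofReal b) :
    Integrable f P ∧ ∫ x, f x ∂P ≤ b := by
  refine ⟨⟨hf, ?_⟩, ?_⟩
  · rw [hasFiniteIntegral_iff_ofReal (ae_of_all _ h0)]
    exact h.trans_lt ENNReal.ofReal_lt_top
  · rw [integral_eq_lintegral_of_nonneg_ae (ae_of_all _ h0) hf]
    exact ENNReal.toReal_le_of_le_ofReal hb h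

lemma exists_integrable_one_add_abs_rpow {μ : Measure ℝ} [IsProbabilityMeasure μ]
    (hmom : (∃ a b : ℝ, μ ((Set.Icc a b)ᶜ) = 0) ∨
      ∃ δ : ℝ, 0 < δ ∧ Integrable (fun x : ℝ => |x| ^ ((2 : ℝ) + δ)) μ) :
    ∃ δ : ℝ, 0 < δ ∧ Integrable (fun x : ℝ => (1 + |x|) ^ (2 + δ)) μ := by
  rcases hmom with ⟨a, b, hab⟩ | ⟨δ, hδ, h⟩
  · refine ⟨1, one_pos, integrable_one_add_abs_rpow (by norm_num) ?_⟩
    refine (integrable_const ((|a| + |b|) ^ ((2 : ℝ) + 1))).mono'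
      (measurable_norm.pow_const ((2 : ℝ) + 1)).aestronglyMeasurable ?_
    have hae : ∀ᵐ x ∂μ, x ∈ Set.Icc a b := hab
    filter_upwards [hae] with x hx
    rw [Real.norm_of_nonneg (by positivity)]
    refine Real.rpow_le_rpow (abs_nonneg x) ?_ (by norm_num)
    rw [abs_le]
    constructor <;> linarith [hx.1, hx.2, neg_abs_le a, le_abs_self b, abs_nonneg a, abs_nonneg b]
  · exact ⟨δ, hδ, integrable_one_add_abs_rpow (by linarith) h⟩

lemma integrable_id_of_one_add_abs_rpow {μ : Measure ℝ} {r : ℝ} (hr : 1 ≤ r)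
    (h : Integrable (fun x : ℝ => (1 + |x|) ^ r) μ) : Integrable id μ := by
  refine h.mono' measurable_id.aestronglyMeasurable (ae_of_all _ fun x => ?_)
  have := Real.self_le_rpow_of_one_le (x := 1 + |x|) (by linarith [abs_nonneg x]) hr
  rw [id, Real.norm_eq_abs]
  linarith

section socialCost
variable {k n : ℕ}

lemma SC_nonneg (x : Fin n → ℝ) (y : Fin k → ℝ) : 0 ≤ SC x y :=
  mul_nonneg (by positivity) (Finset.sum_nonneg fun i _ => nearestDist_nonneg y (x i))

lemma inv_mul_sum_le_add {f g : Fin n → ℝ} {c : ℝ} (hc : 0 ≤ c) (h : ∀ i, f i ≤ g i + c) :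
    (n : ℝ)⁻¹ * ∑ i, f i ≤ (n : ℝ)⁻¹ * ∑ i, g i + c := by
  have h1 : (n : ℝ)⁻¹ * ∑ i, f i ≤ (n : ℝ)⁻¹ * ∑ i, (g i + c) :=
    mul_le_mul_of_nonneg_left (Finset.sum_le_sum fun i _ => h i) (by positivity)
  rw [Finset.sum_add_distrib, Finset.sum_const, Finset.card_univ, Fintype.card_fin, nsmul_eq_mul,
    mul_add, ← mul_assoc] at h1
  have h2 : (n : ℝ)⁻¹ * n * c ≤ 1 * c := mul_le_mul_of_nonneg_right inv_mul_le_one hc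
  linarith

lemma SC_le_add_dist [NeZero k] (x x' : Fin n → ℝ) (y : Fin k → ℝ) :
    SC x y ≤ SC x' y + dist x x' := by
  refine inv_mul_sum_le_add dist_nonneg fun i => (nearestDist_sub_le y (x i) (x' i)).trans ?_
  have := dist_le_pi_dist x x' i
  rw [Real.dist_eq] at this
  exact add_le_add_right this (nearestDist y (x' i))

lemma SC_le_add_sum [NeZero k] (x : Fin n → ℝ) (y y' : Fin k → ℝ) :
    SC x y ≤ SC x y' + ∑ j, |y j - y' j| :=
  inv_mul_sum_le_add (Finset.sum_nonneg fun _ _ => abs_nonneg _)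
    fun i => nearestDist_le_add_sum y y' (x i)

lemma abs_SC_sub_le [NeZero k] (x : Fin n → ℝ) (y y' : Fin k → ℝ) :
    |SC x y - SC x y'| ≤ ∑ j, |y j - y' j| := by
  have h1 := SC_le_add_sum x y y'
  have h2 := SC_le_add_sum x y' y
  simp only [abs_sub_comm (y' _)] at h2
  rw [abs_le]
  constructor <;> linarith

lemma SCopt_le (x : Fin n → ℝ) (y : Fin k → ℝ) : SCopt k x ≤ SC x y :=
  ciInf_le ⟨0, by rintro _ ⟨y, rfl⟩; exact SC_nonneg x y⟩ y

lemma SCopt_nonneg (x : Fin n → ℝ) : 0 ≤ SCopt k x :=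
  Real.iInf_nonneg fun y => SC_nonneg x y

lemma SCopt_lipschitz [NeZero k] : LipschitzWith 1 (SCopt k : (Fin n → ℝ) → ℝ) := by
  refine LipschitzWith.of_le_add fun x x' => ?_
  rw [← sub_le_iff_le_add]
  refine le_ciInf fun y => ?_
  linarith [SC_le_add_dist x x' y, SCopt_le x y]

variable {μ : Measure ℝ} [IsProbabilityMeasure μ]

lemma integrable_SC [NeZero k] (hμ : Integrable id μ) (y : Fin k → ℝ) :
    Integrable (fun x : Fin n → ℝ => SC x y) (Measure.pi fun _ : Fin n => μ) :=
  (integrable_finsetSum _ fun _ _ => integrable_comp_eval (μ := fun _ : Fin n => μ)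
    (nearestDist_integrable hμ y)).const_mul _

lemma integral_SC [NeZero k] (hn : 0 < n) (hμ : Integrable id μ) (y : Fin k → ℝ) :
    ∫ x : Fin n → ℝ, SC x y ∂(Measure.pi fun _ : Fin n => μ) = ∫ x, nearestDist y x ∂μ := by
  change ∫ x : Fin n → ℝ, (n : ℝ)⁻¹ * ∑ i, nearestDist y (x i) ∂_ = _
  rw [integral_const_mul, integral_finsetSum _ fun i _ =>
    integrable_comp_eval (μ := fun _ : Fin n => μ) (nearestDist_integrable hμ y)]
  simp only [integral_comp_eval (μ := fun _ : Fin n => μ)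
    (nearestDist_integrable hμ y).aestronglyMeasurable, Finset.sum_const, Finset.card_univ,
    Fintype.card_fin, nsmul_eq_mul]
  field_simp

lemma integrable_SCopt [NeZero k] (hμ : Integrable id μ) :
    Integrable (fun x : Fin n → ℝ => SCopt k x) (Measure.pi fun _ : Fin n => μ) := by
  refine (integrable_SC hμ (0 : Fin k → ℝ)).mono' SCopt_lipschitz.continuous.aestronglyMeasurable
    (ae_of_all _ fun x => ?_)
  rw [Real.norm_of_nonneg (SCopt_nonneg x)]
  exact SCopt_le x 0

lemma integral_SCopt_le_projDist [NeZero k] (hn : 0 < n) (hμ : Integrable id μ) :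
    ∫ x : Fin n → ℝ, SCopt k x ∂(Measure.pi fun _ : Fin n => μ) ≤ projDist k μ := by
  refine le_projDist hμ fun y => ?_
  rw [← integral_SC hn hμ y]
  exact integral_mono (integrable_SCopt hμ) (integrable_SC hμ y) fun x => SCopt_le x y

lemma ofReal_projDist_sub_SCopt_le [NeZero k] (hn : 0 < n) (hμ : Integrable id μ)
    (x : Fin n → ℝ) : ENNReal.ofReal (projDist k μ - SCopt k x) ≤
      ∫⁻ t, ENNReal.ofReal |empCdf t x - μ.real (Set.Iic t)| := by
  set D := ∫⁻ t, ENNReal.ofReal |empCdf t x - μ.real (Set.Iic t)| with hD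
  rcases eq_or_ne D ∞ with h | h
  · rw [h]; exact le_top
  have := empMeas_isProbabilityMeasure hn x
  refine ENNReal.ofReal_le_of_le_toReal ?_
  have : projDist k μ - D.toReal ≤ SCopt k x := by
    refine le_ciInf fun y => ?_
    have h1 := ofReal_integral_sub_le (nearestDist_lipschitz y) hμ (integrable_empMeas hn x id)
    simp only [empMeas_real_Iic] at h1
    rw [← hD, ENNReal.ofReal_le_iff_le_toReal h, integral_empMeas] at h1
    have h2 := projDist_le hμ y
    change projDist k μ - D.toReal ≤ (n : ℝ)⁻¹ * ∑ i, nearestDist y (x i)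
    linarith
  linarith

lemma projDist_sub_le_integral_SCopt [NeZero k] (hn : 0 < n) (hμ : Integrable id μ)
    (hK : Integrable fun t : ℝ => √(μ.real (Set.Iic t) * (1 - μ.real (Set.Iic t)))) :
    projDist k μ - (∫ t : ℝ, √(μ.real (Set.Iic t) * (1 - μ.real (Set.Iic t)))) / √n ≤
      ∫ x : Fin n → ℝ, SCopt k x ∂(Measure.pi fun _ : Fin n => μ) := by
  set K := ∫ t : ℝ, √(μ.real (Set.Iic t) * (1 - μ.real (Set.Iic t)))
  have hK0 : 0 ≤ K := integral_nonneg fun _ => Real.sqrt_nonneg _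
  set P := Measure.pi fun _ : Fin n => μ
  have hi : Integrable (fun x : Fin n → ℝ => projDist k μ - SCopt k x) P :=
    (integrable_const _).sub (integrable_SCopt hμ)
  have h2 : ∫⁻ x, ENNReal.ofReal (max (projDist k μ - SCopt k x) 0) ∂P ≤
      ENNReal.ofReal (K / √n) := by
    refine (lintegral_mono fun x => ?_).trans (lintegral_lintegral_abs_empCdf_sub_le μ hn hK)
    rw [ENNReal.ofReal_max, ENNReal.ofReal_zero, max_eq_left zero_le]
    exact ofReal_projDist_sub_SCopt_le hn hμ x
  obtain ⟨h3, h4⟩ := integrable_and_integral_le_of_lintegral_le hi.pos_part.aestronglyMeasurable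
    (fun _ => le_max_right _ _) (by positivity) h2
  have h5 := (integral_mono hi h3 fun x => le_max_left _ _).trans h4
  rw [integral_sub (integrable_const _) (integrable_SCopt hμ), integral_const, probReal_univ,
    one_smul] at h5
  linarith

lemma measurable_SCv (hn : 0 < n) (v : Fin k → ℝ) :
    Measurable fun x : Fin n → ℝ => SCv v x := by
  refine Measurable.const_mul (Finset.measurable_fun_sum _ fun i _ => ?_) _
  exact Measurable.iInf fun j =>
    ((measurable_pi_apply i).sub (measurable_percentileMech hn v j)).abs

lemma abs_integral_SCv_sub_le [NeZero k] (hn : 0 < n) (hμ : Integrable id μ) (v q : Fin k → ℝ)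
    {C : Fin k → ℝ} (hC : ∀ j, ∫⁻ x : Fin n → ℝ, ENNReal.ofReal |percentileMech v x j - q j|
      ∂(Measure.pi fun _ : Fin n => μ) ≤ ENNReal.ofReal (C j / √n)) :
    |(∫ x : Fin n → ℝ, SCv v x ∂(Measure.pi fun _ : Fin n => μ)) - ∫ x, nearestDist q x ∂μ| ≤
      (∑ j, |C j|) / √n := by
  set P := Measure.pi fun _ : Fin n => μ
  have h1 : ∀ j, Integrable (fun x : Fin n → ℝ => |percentileMech v x j - q j|) P ∧
      ∫ x, |percentileMech v x j - q j| ∂P ≤ |C j| / √n := fun j =>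
    integrable_and_integral_le_of_lintegral_le
      ((measurable_percentileMech hn v j).sub_const _).abs.aestronglyMeasurable
      (fun _ => abs_nonneg _) (by positivity)
      ((hC j).trans (ENNReal.ofReal_le_ofReal (by gcongr; exact le_abs_self _)))
  have hsum : Integrable (fun x : Fin n → ℝ => ∑ j, |percentileMech v x j - q j|) P :=
    integrable_finsetSum _ fun j _ => (h1 j).1
  have hdiff : Integrable (fun x : Fin n → ℝ => SCv v x - SC x q) P :=
    hsum.mono' ((measurable_SCv hn v).aestronglyMeasurable.sub
      (integrable_SC hμ q).aestronglyMeasurable) (ae_of_all _ fun x => abs_SC_sub_le x _ q)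
  have hSCv : Integrable (fun x : Fin n → ℝ => SCv v x) P :=
    (hdiff.add (integrable_SC hμ q)).congr (ae_of_all _ fun x => sub_add_cancel _ _)
  rw [← integral_SC hn hμ q, ← integral_sub hSCv (integrable_SC hμ q)]
  refine (abs_integral_le_integral_abs).trans ?_
  refine (integral_mono hdiff.abs hsum fun x => abs_SC_sub_le x _ q).trans ?_
  rw [integral_finsetSum _ fun j _ => (h1 j).1, Finset.sum_div]
  exact Finset.sum_le_sum fun j _ => (h1 j).2
end socialCost

/-- An eventual rate `C / √n` holds for all positive `n` after enlarging the constant. -/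
lemma exists_pos_bound_div_sqrt {f : ℕ → ℝ} {C N : ℝ}
    (h : ∀ n : ℕ, 0 < n → N ≤ n → |f n| ≤ C / √n) :
    ∃ C' : ℝ, 0 < C' ∧ ∀ n : ℕ, 0 < n → |f n| ≤ C' / √n := by
  have hS : ∀ i ∈ Finset.range ⌈N⌉₊, 0 ≤ |f i| * √(i : ℝ) := fun i _ => by positivity
  refine ⟨|C| + 1 + ∑ i ∈ Finset.range ⌈N⌉₊, |f i| * √(i : ℝ),
    by have := Finset.sum_nonneg hS; positivity, fun n hn => ?_⟩
  have hn' : 0 < √(n : ℝ) := Real.sqrt_pos.2 (by exact_mod_cast hn)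
  rw [le_div_iff₀ hn']
  rcases le_or_gt N n with hN | hN
  · have := h n hn hN
    rw [le_div_iff₀ hn'] at this
    linarith [Finset.sum_nonneg hS, le_abs_self C]
  · have := Finset.single_le_sum hS (Finset.mem_range.2 (Nat.lt_ceil.2 hN))
    linarith [abs_nonneg C]

lemma abs_div_sub_div_le {a b A B e e' : ℝ} (hA : 0 ≤ A) (hB : 0 < B) (hb : B / 2 ≤ b)
    (h1 : |a - A| ≤ e) (h2 : |b - B| ≤ e') :
    |a / b - A / B| ≤ 2 / B * e + 2 * A / B ^ 2 * e' := by
  have hb0 : 0 < b := by linarith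
  have h : a / b - A / B = (a - A) / b - A / (b * B) * (b - B) := by
    field_simp
    ring
  rw [h]
  refine (abs_sub _ _).trans (add_le_add ?_ ?_)
  · rw [abs_div, abs_of_pos hb0, div_le_iff₀ hb0]
    have he : 0 ≤ e := (abs_nonneg _).trans h1
    calc |a - A| ≤ e := h1
      _ = 2 / B * e * (B / 2) := by field_simp
      _ ≤ 2 / B * e * b := by gcongr
  · rw [abs_mul, abs_of_nonneg (by positivity)]
    refine mul_le_mul ?_ h2 (abs_nonneg _) (by positivity)
    rw [div_le_div_iff₀ (by positivity) (by positivity)]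
    have : A * B * (B / 2) ≤ A * B * b := by gcongr
    nlinarith

/-- Convergence rate `O(n^{-1/2})` of the Bayesian approximation ratio of the
percentile mechanism, under compact support or a finite `(2+δ)`-th moment. -/
theorem stmt7 (μ : Measure ℝ) (hμ : BasicAssumptions μ)
    (hmom : (∃ a b : ℝ, μ ((Set.Icc a b)ᶜ) = 0) ∨
      ∃ δ : ℝ, 0 < δ ∧ Integrable (fun x : ℝ => |x| ^ ((2 : ℝ) + δ)) μ)
    {k : ℕ} (hk : 1 ≤ k)
    (v : Fin k → ℝ) (hv : Monotone v) (hv01 : ∀ j, v j ∈ Set.Ioo (0 : ℝ) 1) :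
    ∃ C : ℝ, 0 < C ∧ ∀ n : ℕ, k < n →
      |(∫ x : Fin n → ℝ, SCv v x ∂(Measure.pi fun _ : Fin n => μ)) /
          (∫ x : Fin n → ℝ, SCopt k x ∂(Measure.pi fun _ : Fin n => μ)) -
        W1 μ (nuQ μ v) / projDist k μ| ≤ C / Real.sqrt n ∧
      (∫ x : Fin n → ℝ, SCv v x ∂(Measure.pi fun _ : Fin n => μ)) /
          (∫ x : Fin n → ℝ, SCopt k x ∂(Measure.pi fun _ : Fin n => μ)) ≤
        W1 μ (nuQ μ v) / projDist k μ + C / Real.sqrt n := by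
  have hprob : IsProbabilityMeasure μ := hμ.1
  have hk0 : NeZero k := ⟨by omega⟩
  obtain ⟨δ, hδ, hr⟩ := exists_integrable_one_add_abs_rpow hmom
  have hi : Integrable id μ := integrable_id_of_one_add_abs_rpow (by linarith) hr
  have hK := integrable_sqrt_cdf hδ hr
  obtain ⟨b, hb, hbd⟩ := exists_pos_le_integral_nearestDist hμ hi k
  have hB : 0 < projDist k μ := hb.trans_le (le_projDist hi hbd)
  set B := projDist k μ
  set q : Fin k → ℝ := fun j => mquantile μ (v j)
  have hq : Monotone q := fun i j hij => mquantile_mono (hv01 i).1 (hv hij) (hv01 j).2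
  have hA : W1 μ (nuQ μ v) = ∫ x, nearestDist q x ∂μ := W1_voronoiMeasure hi hq
  have hA0 : 0 ≤ W1 μ (nuQ μ v) := W1_nonneg _ _
  set A := W1 μ (nuQ μ v)
  have hrate : ∀ j, ∃ C N : ℝ, ∀ n : ℕ, 0 < n → N ≤ n →
      ∫⁻ x : Fin n → ℝ, ENNReal.ofReal |percentileMech v x j - q j|
        ∂(Measure.pi fun _ : Fin n => μ) ≤ ENNReal.ofReal (C / √n) := by
    intro j
    obtain ⟨c, ε, hc, hε, hg⟩ := exists_linear_growth hμ (hv01 j)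
    exact lintegral_percentileMech_sub_le (by linarith) hr v j (hv01 j) hc hε hg
  choose C N hCN using hrate
  set K := ∫ t : ℝ, √(μ.real (Set.Iic t) * (1 - μ.real (Set.Iic t)))
  have hK0 : 0 ≤ K := integral_nonneg fun _ => Real.sqrt_nonneg _
  obtain ⟨C', hC', hbound⟩ := exists_pos_bound_div_sqrt
    (f := fun n => (∫ x : Fin n → ℝ, SCv v x ∂(Measure.pi fun _ : Fin n => μ)) /
          (∫ x : Fin n → ℝ, SCopt k x ∂(Measure.pi fun _ : Fin n => μ)) - A / B)
    (C := 2 / B * (∑ j, |C j|) + 2 * A / B ^ 2 * K) (N := ∑ j, |N j| + (2 * K / B) ^ 2) (by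
      intro n hn hN
      have hn' : 0 < √(n : ℝ) := Real.sqrt_pos.2 (by exact_mod_cast hn)
      have hNj : ∀ j, N j ≤ n := fun j => by
        have := Finset.single_le_sum (f := fun j => |N j|) (fun i _ => abs_nonneg _)
          (Finset.mem_univ j)
        linarith [le_abs_self (N j), sq_nonneg (2 * K / B)]
      have h1 := abs_integral_SCv_sub_le hn hi v q fun j => hCN j n hn (hNj j)
      have h2 := integral_SCopt_le_projDist (k := k) hn hi
      have h3 := projDist_sub_le_integral_SCopt (k := k) hn hi hK
      have h4 : K / √n ≤ B / 2 := by
        have : 2 * K / B ≤ √n := Real.le_sqrt_of_sq_le (by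
          linarith [Finset.sum_nonneg fun j (_ : j ∈ Finset.univ) => abs_nonneg (N j)])
        rw [div_le_iff₀ hB] at this
        rw [div_le_iff₀ hn']
        linarith
      rw [← hA] at h1
      refine (abs_div_sub_div_le hA0 hB (by linarith) h1 (e' := K / √n) ?_).trans
        (le_of_eq (by ring))
      rw [abs_le]
      constructor <;> linarith [div_nonneg hK0 hn'.le])
  refine ⟨C', hC', fun n hn => ?_⟩
  have h := hbound n (by omega)
  exact ⟨h, by linarith [(abs_le.1 h).2]⟩
end

section
/- Let μ be a Borel probability measure on ℝ satisfying the basic assumptions and with finite first moment, let k ≥ 1, and suppose ν* = ∑_{j=1}^k ν*_j δ_{y_j} with y_1 < y_2 < … < y_k attains inf_{ν ∈ 𝒫_k(ℝ)} W₁(μ,ν). Then the optimal weights are the masses of the Voronoi cells of the support: ν*_j = F_μ(z_j) − F_μ(z_{j−1}) for every j, where z_j := (y_j + y_{j+1})/2 for 1 ≤ j ≤ k−1, F_μ(z_0) := 0 and F_μ(z_k) := 1. Equivalently, ν* = ν_{Q_{v_μ}} where (v_μ)_j := F_μ(y_j). -/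
open MeasureTheory Filter Topology ENNReal

lemma exists_measurable_nearest {k : ℕ} (hk : 1 ≤ k) (y : Fin k → ℝ) :
    ∃ T : ℝ → ℝ, Measurable T ∧ (∀ x, T x ∈ Set.range y) ∧
      ∀ x i, |x - T x| ≤ |x - y i| := by
  set e : ℕ → ℝ := fun n => y ⟨min n (k - 1), by omega⟩ with he
  refine ⟨SimpleFunc.nearestPt e k, (SimpleFunc.nearestPt e k).measurable, fun x => ?_,
    fun x i => ?_⟩
  · exact ⟨_, rfl⟩
  · have h := SimpleFunc.edist_nearestPt_le e x (k := i) (N := k) i.2.le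
    have hi : e i = y i := by
      simp only [he]
      congr 1
      ext
      simp only
      omega
    rw [hi, edist_dist, edist_dist, ENNReal.ofReal_le_ofReal_iff dist_nonneg,
      Real.dist_eq, Real.dist_eq, abs_sub_comm, abs_sub_comm (y i)] at h
    exact h

lemma integrable_abs_sub_of_finite_range {k : ℕ} {μ : Measure ℝ} [IsProbabilityMeasure μ]
    (hint : Integrable (fun x : ℝ => |x|) μ) {y : Fin k → ℝ} {T : ℝ → ℝ} (hT : Measurable T)
    (hTy : ∀ x, T x ∈ Set.range y) : Integrable (fun x => |x - T x|) μ := by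
  refine Integrable.mono' (hint.add (integrable_const (∑ i, |y i|)))
    (by fun_prop) (ae_of_all _ fun x => ?_)
  obtain ⟨i, hi⟩ := hTy x
  have h1 : |y i| ≤ ∑ i, |y i| :=
    Finset.single_le_sum (f := fun i => |y i|) (fun _ _ => abs_nonneg _) (Finset.mem_univ i)
  rw [Real.norm_eq_abs, abs_abs, ← hi]
  exact (abs_sub x (y i)).trans (by simpa using h1)

lemma bddBelow_transport_costs (α β : Measure ℝ) :
    BddBelow {c : ℝ | ∃ π : Measure (ℝ × ℝ), IsProbabilityMeasure π ∧
      π.map Prod.fst = α ∧ π.map Prod.snd = β ∧ c = ∫ p, |p.1 - p.2| ∂π} := by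
  refine ⟨0, ?_⟩
  rintro c ⟨π, -, -, -, rfl⟩
  exact integral_nonneg fun _ => abs_nonneg _

lemma projDist_le_integral {k : ℕ} {μ : Measure ℝ} [IsProbabilityMeasure μ]
    {y : Fin k → ℝ} {T : ℝ → ℝ} (hT : Measurable T) (hTy : ∀ x, T x ∈ Set.range y) :
    projDist k μ ≤ ∫ x, |x - T x| ∂μ := by
  have hP : μ.map T ∈ Pk k := by
    refine ⟨Measure.isProbabilityMeasure_map hT.aemeasurable, Finset.univ.image y,
      Finset.card_image_le.trans (by simp), ?_⟩
    rw [Measure.map_apply hT (Finset.measurableSet _).compl]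
    convert measure_empty (μ := μ)
    ext x
    simpa using hTy x
  have h1 : projDist k μ ≤ W1 μ (μ.map T) := by
    refine csInf_le ⟨0, ?_⟩ ⟨_, hP, rfl⟩
    rintro c ⟨ν, -, rfl⟩
    exact W1_nonneg _ _
  have hm : Measurable fun x => (x, T x) := by fun_prop
  refine h1.trans (csInf_le (bddBelow_transport_costs _ _) ⟨μ.map fun x => (x, T x),
    Measure.isProbabilityMeasure_map hm.aemeasurable, ?_, ?_, ?_⟩)
  · rw [Measure.map_map measurable_fst hm]
    exact Measure.map_id
  · rw [Measure.map_map measurable_snd hm]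
    rfl
  · rw [integral_map hm.aemeasurable (by fun_prop)]

lemma projDist_le_integral_of_le {k : ℕ} (hk : 1 ≤ k) {μ : Measure ℝ} [IsProbabilityMeasure μ]
    (hint : Integrable (fun x : ℝ => |x|) μ) (y : Fin k → ℝ) {f : ℝ → ℝ} (hf : Integrable f μ)
    (hle : ∀ᵐ x ∂μ, ∃ i, |x - y i| ≤ f x) : projDist k μ ≤ ∫ x, f x ∂μ := by
  obtain ⟨T, hT, hTy, hTn⟩ := exists_measurable_nearest hk y
  refine (projDist_le_integral hT hTy).trans (integral_mono_ae
    (integrable_abs_sub_of_finite_range hint hT hTy) hf ?_)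
  filter_upwards [hle] with x ⟨i, hi⟩ using (hTn x i).trans hi

section Coupling

variable {k : ℕ} {μ ν : Measure ℝ} {y : Fin k → ℝ} {π : Measure (ℝ × ℝ)}

lemma ae_snd_mem_range (h2 : π.map Prod.snd = ν) (hν : ν (Set.range y)ᶜ = 0) :
    ∀ᵐ p ∂π, p.2 ∈ Set.range y := by
  rw [← h2, Measure.map_apply measurable_snd (Set.finite_range y).measurableSet.compl] at hν
  exact hν

lemma integrable_transport_cost [IsProbabilityMeasure π]
    (hint : Integrable (fun x : ℝ => |x|) μ) (h1 : π.map Prod.fst = μ)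
    (h2 : π.map Prod.snd = ν) (hν : ν (Set.range y)ᶜ = 0) :
    Integrable (fun p : ℝ × ℝ => |p.1 - p.2|) π := by
  have hi : Integrable (fun p : ℝ × ℝ => |p.1|) π := by
    rw [← h1] at hint
    exact hint.comp_measurable measurable_fst
  refine Integrable.mono' (hi.add (integrable_const (∑ i, |y i|))) (by fun_prop) ?_
  filter_upwards [ae_snd_mem_range h2 hν] with p ⟨i, hpi⟩
  have h1 : |y i| ≤ ∑ i, |y i| :=
    Finset.single_le_sum (f := fun i => |y i|) (fun _ _ => abs_nonneg _) (Finset.mem_univ i)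
  rw [Real.norm_eq_abs, abs_abs, ← hpi]
  exact (abs_sub p.1 (y i)).trans (by simpa using h1)

lemma integral_nearest_le_transport_cost [IsProbabilityMeasure μ] [IsProbabilityMeasure π]
    (hint : Integrable (fun x : ℝ => |x|) μ) (h1 : π.map Prod.fst = μ)
    (h2 : π.map Prod.snd = ν) (hν : ν (Set.range y)ᶜ = 0) {T : ℝ → ℝ} (hT : Measurable T)
    (hTy : ∀ x, T x ∈ Set.range y) (hTn : ∀ x i, |x - T x| ≤ |x - y i|) :
    ∫ x, |x - T x| ∂μ ≤ ∫ p, |p.1 - p.2| ∂π := by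
  have hd := integrable_abs_sub_of_finite_range hint hT hTy
  rw [← h1] at hd
  have he : ∫ x, |x - T x| ∂μ = ∫ p : ℝ × ℝ, |p.1 - T p.1| ∂π := by
    rw [← h1, integral_map measurable_fst.aemeasurable (by fun_prop)]
  rw [he]
  refine integral_mono_ae (hd.comp_measurable measurable_fst)
    (integrable_transport_cost hint h1 h2 hν) ?_
  filter_upwards [ae_snd_mem_range h2 hν] with p ⟨i, hpi⟩
  simpa only [← hpi] using hTn p.1 i

lemma measureReal_atom_le_add_excess_cost [IsProbabilityMeasure μ] [IsProbabilityMeasure π]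
    (hint : Integrable (fun x : ℝ => |x|) μ) (h1 : π.map Prod.fst = μ)
    (h2 : π.map Prod.snd = ν) (hν : ν (Set.range y)ᶜ = 0) {T : ℝ → ℝ} (hT : Measurable T)
    (hTy : ∀ x, T x ∈ Set.range y) (hTn : ∀ x i, |x - T x| ≤ |x - y i|) (a : ℝ)
    {c : ℝ} (hc : 0 < c) :
    ν.real {a} ≤ μ.real {x | |x - a| < |x - T x| + c} +
      (∫ p, |p.1 - p.2| ∂π - ∫ x, |x - T x| ∂μ) / c := by
  have hd := integrable_abs_sub_of_finite_range hint hT hTy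
  rw [← h1] at hd
  have he : ∫ x, |x - T x| ∂μ = ∫ p : ℝ × ℝ, |p.1 - T p.1| ∂π := by
    rw [← h1, integral_map measurable_fst.aemeasurable (by fun_prop)]
  have hdi : Integrable (fun p : ℝ × ℝ => |p.1 - T p.1|) π := hd.comp_measurable measurable_fst
  have hci := integrable_transport_cost hint h1 h2 hν
  have hmeas : MeasurableSet {x | |x - a| < |x - T x| + c} :=
    measurableSet_lt (by fun_prop) (by fun_prop)
  have hmarkov := mul_meas_ge_le_integral_of_nonneg
    (f := fun p : ℝ × ℝ => |p.1 - p.2| - |p.1 - T p.1|) (μ := π) (by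
      filter_upwards [ae_snd_mem_range h2 hν] with p ⟨i, hpi⟩
      simpa only [← hpi, Pi.zero_apply, sub_nonneg] using hTn p.1 i) (hci.sub hdi) c
  rw [he, ← integral_sub hci hdi]
  have hsub : Prod.snd ⁻¹' {a} ⊆ Prod.fst ⁻¹' {x | |x - a| < |x - T x| + c} ∪
      {p : ℝ × ℝ | c ≤ |p.1 - p.2| - |p.1 - T p.1|} := by
    intro p hp
    have hp' : p.2 = a := hp
    by_cases h : |p.1 - a| < |p.1 - T p.1| + c
    · exact Or.inl h
    · refine Or.inr ?_
      simp only [Set.mem_ofPred_eq, hp']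
      linarith
  have hν' : ν.real {a} = π.real (Prod.snd ⁻¹' {a}) := by
    rw [← h2, map_measureReal_apply measurable_snd (measurableSet_singleton a)]
  have hμ' : μ.real {x | |x - a| < |x - T x| + c} =
      π.real (Prod.fst ⁻¹' {x | |x - a| < |x - T x| + c}) := by
    rw [← map_measureReal_apply measurable_fst hmeas, h1]
  rw [hν', hμ']
  refine (measureReal_mono hsub).trans ((measureReal_union_le _ _).trans ?_)
  gcongr
  rw [le_div_iff₀ hc, mul_comm]
  exact hmarkov

lemma integral_nearest_le_W1 [IsProbabilityMeasure μ] [IsProbabilityMeasure ν]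
    (hint : Integrable (fun x : ℝ => |x|) μ) (hν : ν (Set.range y)ᶜ = 0)
    {T : ℝ → ℝ} (hT : Measurable T)
    (hTy : ∀ x, T x ∈ Set.range y) (hTn : ∀ x i, |x - T x| ≤ |x - y i|) :
    ∫ x, |x - T x| ∂μ ≤ W1 μ ν := by
  refine le_csInf ⟨_, μ.prod ν, inferInstance, ?_, ?_, rfl⟩ ?_
  · simp [Measure.map_fst_prod]
  · simp [Measure.map_snd_prod]
  · rintro c ⟨π, hπ, h1, h2, rfl⟩
    exact integral_nearest_le_transport_cost hint h1 h2 hν hT hTy hTn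

lemma measureReal_atom_le_measureReal_nearest [IsProbabilityMeasure μ] [IsProbabilityMeasure ν]
    (hint : Integrable (fun x : ℝ => |x|) μ) (hν : ν (Set.range y)ᶜ = 0)
    {T : ℝ → ℝ} (hT : Measurable T)
    (hTy : ∀ x, T x ∈ Set.range y) (hTn : ∀ x i, |x - T x| ≤ |x - y i|)
    (hW : W1 μ ν ≤ ∫ x, |x - T x| ∂μ) (a : ℝ) :
    ν.real {a} ≤ μ.real {x | |x - a| ≤ |x - T x|} := by
  have hstep : ∀ c > 0, ν.real {a} ≤ μ.real {x | |x - a| < |x - T x| + c} := by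
    intro c hc
    refine le_of_forall_pos_le_add fun ε hε => ?_
    have hne : {c : ℝ | ∃ π : Measure (ℝ × ℝ), IsProbabilityMeasure π ∧
        π.map Prod.fst = μ ∧ π.map Prod.snd = ν ∧ c = ∫ p, |p.1 - p.2| ∂π}.Nonempty :=
      ⟨_, μ.prod ν, inferInstance, by simp [Measure.map_fst_prod],
        by simp [Measure.map_snd_prod], rfl⟩
    have hlt : W1 μ ν < ∫ x, |x - T x| ∂μ + ε * c := by
      have := mul_pos hε hc
      linarith
    obtain ⟨_, ⟨π, hπ, h1, h2, rfl⟩, hcost⟩ := exists_lt_of_csInf_lt hne hlt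
    refine (measureReal_atom_le_add_excess_cost hint h1 h2 hν hT hTy hTn a hc).trans ?_
    gcongr
    rw [div_le_iff₀ hc]
    linarith
  have hset : {x | |x - a| ≤ |x - T x|} =
      ⋂ n : ℕ, {x | |x - a| < |x - T x| + 1 / ((n : ℝ) + 1)} := by
    ext x
    simp only [Set.mem_ofPred_eq, Set.mem_iInter]
    constructor
    · intro h n
      have : (0 : ℝ) < 1 / ((n : ℝ) + 1) := Nat.one_div_pos_of_nat
      linarith
    · intro h
      refine le_of_forall_pos_le_add fun ε hε => ?_
      obtain ⟨n, hn⟩ := exists_nat_one_div_lt hε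
      linarith [h n]
  have hlim := tendsto_measure_iInter_atTop (μ := μ)
    (s := fun n : ℕ => {x | |x - a| < |x - T x| + 1 / ((n : ℝ) + 1)})
    (fun n => (measurableSet_lt (by fun_prop) (by fun_prop)).nullMeasurableSet)
    (fun m n hmn x hx => by
      simp only [Set.mem_ofPred_eq] at hx ⊢
      have := Nat.one_div_le_one_div (α := ℝ) hmn
      linarith)
    ⟨0, measure_ne_top _ _⟩
  rw [← hset] at hlim
  exact ge_of_tendsto' ((ENNReal.tendsto_toReal (measure_ne_top _ _)).comp hlim)
    fun n => hstep _ Nat.one_div_pos_of_nat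

end Coupling

lemma mcdf_eq_measureReal_Iio (μ : Measure ℝ) [NullSingletonClass μ] (t : ℝ) :
    mcdf μ t = μ.real (Set.Iio t) := by
  rw [mcdf, ← measure_congr Iio_ae_eq_Iic]
  rfl

lemma measureReal_voronoi_le {k : ℕ} {μ : Measure ℝ} [IsProbabilityMeasure μ]
    [NullSingletonClass μ] {y : Fin k → ℝ} (hy : StrictMono y) (j : Fin k) :
    μ.real {x | ∀ i, |x - y j| ≤ |x - y i|} ≤ cellBd μ y (j + 1) - cellBd μ y j := by
  set N := {x | ∀ i, |x - y j| ≤ |x - y i|} with hN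
  have hNm : MeasurableSet N := by
    have : N = ⋂ i, {x | |x - y j| ≤ |x - y i|} := by ext; simp [hN]
    rw [this]
    exact MeasurableSet.iInter fun i => measurableSet_le (by fun_prop) (by fun_prop)
  obtain ⟨A, hA, hAN, hAy⟩ : ∃ A, cellBd μ y j = μ.real A ∧ Disjoint A N ∧ ∀ x ∈ A, x ≤ y j := by
    by_cases h0 : (j : ℕ) = 0
    · exact ⟨∅, by simp [cellBd, h0], by simp, by simp⟩
    · have hlt : y ⟨j - 1, by omega⟩ < y j := hy (by rw [Fin.lt_def]; simp only; omega)
      refine ⟨Set.Iio ((y ⟨j - 1, by omega⟩ + y j) / 2), ?_, ?_, ?_⟩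
      · rw [cellBd, dif_neg h0, dif_neg (by omega), mcdf_eq_measureReal_Iio]
      · rw [Set.disjoint_left]
        intro x hx hxN
        have h := sq_le_sq.2 (hxN ⟨j - 1, by omega⟩)
        nlinarith [Set.mem_Iio.1 hx]
      · intro x hx
        linarith [Set.mem_Iio.1 hx]
  obtain ⟨B, hB, hNB, hBy⟩ : ∃ B, cellBd μ y (j + 1) = μ.real B ∧ N ⊆ B ∧ ∀ x ≤ y j, x ∈ B := by
    by_cases h1 : k ≤ (j : ℕ) + 1
    · exact ⟨Set.univ, by simp [cellBd, h1], Set.subset_univ _, by simp⟩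
    · have hlt : y j < y ⟨j + 1, by omega⟩ := hy (by rw [Fin.lt_def]; simp)
      refine ⟨Set.Iic ((y j + y ⟨j + 1, by omega⟩) / 2), ?_, ?_, ?_⟩
      · rw [cellBd, dif_neg (by omega), dif_neg h1]
        rfl
      · intro x hxN
        have h := sq_le_sq.2 (hxN ⟨j + 1, by omega⟩)
        rw [Set.mem_Iic]
        nlinarith
      · intro x hx
        rw [Set.mem_Iic]
        linarith
  rw [hA, hB, le_sub_iff_add_le, add_comm, ← measureReal_union hAN hNm]
  exact measureReal_mono (Set.union_subset (fun x hx => hBy x (hAy x hx)) hNB)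

lemma sum_cellBd_sub {k : ℕ} (hk : 1 ≤ k) (μ : Measure ℝ) (y : Fin k → ℝ) :
    ∑ j : Fin k, (cellBd μ y ((j : ℕ) + 1) - cellBd μ y (j : ℕ)) = 1 := by
  rw [Fin.sum_univ_eq_sum_range (fun j => cellBd μ y (j + 1) - cellBd μ y j),
    Finset.sum_range_sub]
  have : k ≠ 0 := by omega
  simp [cellBd, this]

lemma BasicAssumptions.nullSingletonClass {μ : Measure ℝ} (hμ : BasicAssumptions μ) :
    NullSingletonClass μ := by
  obtain ⟨-, ρ, S, h, -⟩ := hμ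
  refine ⟨fun x => ?_⟩
  rw [h]
  exact withDensity_absolutelyContinuous _ _ (measure_singleton x)

lemma BasicAssumptions.exists_ordConnected {μ : Measure ℝ} (hμ : BasicAssumptions μ) :
    ∃ S : Set ℝ, S.OrdConnected ∧ μ Sᶜ = 0 ∧
      ∀ a b, a < b → Set.Ioo a b ⊆ S → μ (Set.Ioo a b) ≠ 0 := by
  obtain ⟨-, ρ, S, h, -, hS, hSc, hpos, -, hdiff⟩ := hμ
  refine ⟨S, hS, hSc, fun a b hab hsub h0 => ?_⟩
  have hmeas : AEMeasurable (fun x => ENNReal.ofReal (ρ x)) (volume.restrict (Set.Ioo a b)) :=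
    ((hdiff.continuousOn.mono hsub).aemeasurable measurableSet_Ioo).ennreal_ofReal
  rw [h, withDensity_apply _ measurableSet_Ioo, lintegral_eq_zero_iff' hmeas,
    Filter.EventuallyEq, ae_restrict_iff' measurableSet_Ioo] at h0
  have hvol : volume (Set.Ioo a b) = 0 := by
    refine measure_mono_null (fun x hx => ?_) h0
    have hxi : 0 < ρ x := hpos x (interior_maximal hsub isOpen_Ioo hx)
    simp [hx.1, hx.2, hxi]
  simp only [Real.volume_Ioo, ENNReal.ofReal_eq_zero] at hvol
  linarith

lemma mquantile_mcdf {μ : Measure ℝ} [IsProbabilityMeasure μ] {a : ℝ}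
    (h : ∀ t < a, μ (Set.Ioc t a) ≠ 0) : mquantile μ (mcdf μ a) = a := by
  refine IsLeast.csInf_eq ⟨le_refl (mcdf μ a), fun t ht => ?_⟩
  by_contra! hta
  refine h t hta ?_
  have h1 : μ.real (Set.Iic t) + μ.real (Set.Ioc t a) = μ.real (Set.Iic a) := by
    rw [← measureReal_union (Set.Iic_disjoint_Ioc le_rfl) measurableSet_Ioc,
      Set.Iic_union_Ioc_eq_Iic hta.le]
  have h2 : μ.real (Set.Iic a) ≤ μ.real (Set.Iic t) := ht
  have h3 : μ.real (Set.Ioc t a) = 0 := le_antisymm (by linarith) measureReal_nonneg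
  exact (measureReal_eq_zero_iff).1 h3

section Optimal

variable {k : ℕ} {μ : Measure ℝ} {y : Fin k → ℝ} {T : ℝ → ℝ}

lemma measure_nearest_ne_zero (hk : 1 ≤ k) [IsProbabilityMeasure μ]
    (hint : Integrable (fun x : ℝ => |x|) μ) {S : Set ℝ} [NullSingletonClass μ]
    (hS : S.OrdConnected) (hSc : μ Sᶜ = 0)
    (hpos : ∀ a b, a < b → Set.Ioo a b ⊆ S → μ (Set.Ioo a b) ≠ 0)
    (hT : Measurable T) (hTy : ∀ x, T x ∈ Set.range y)
    (hopt : ∫ x, |x - T x| ∂μ ≤ projDist k μ) (j : Fin k) : μ (T ⁻¹' {y j}) ≠ 0 := by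
  intro h0
  have hSns : ¬ S.Subsingleton := fun h => by
    have h1 := measure_union_le (μ := μ) S Sᶜ
    rw [Set.union_compl_self, measure_univ, hSc, h.measure_zero] at h1
    simp at h1
  obtain ⟨a, ha, b, hb, hab⟩ := (Set.not_subsingleton_iff.1 hSns).exists_lt
  obtain ⟨p, hp, hpy⟩ := ((Set.Ioo_infinite hab).sdiff (Set.finite_range y)).nonempty
  have hIS : Set.Ioo a b ⊆ S := Set.Ioo_subset_Icc_self.trans (hS.out ha hb)
  have hd := integrable_abs_sub_of_finite_range hint hT hTy
  have hp' : Integrable (fun x => |x - p|) μ :=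
    integrable_abs_sub_of_finite_range (y := fun _ : Fin 1 => p) hint measurable_const (by simp)
  have hle : projDist k μ ≤ ∫ x, min |x - T x| |x - p| ∂μ := by
    refine projDist_le_integral_of_le hk hint (Function.update y j p) (hd.inf hp') ?_
    filter_upwards [measure_eq_zero_iff_ae_notMem.1 h0] with x hx
    rcases le_total |x - T x| |x - p| with h | h
    · obtain ⟨i, hi⟩ := hTy x
      have hij : i ≠ j := by
        rintro rfl
        exact hx hi.symm
      exact ⟨i, by rw [Function.update_of_ne hij, hi, min_eq_left h]⟩
    · exact ⟨j, by rw [Function.update_self, min_eq_right h]⟩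
  have hae : (fun x => min |x - T x| |x - p|) =ᵐ[μ] fun x => |x - T x| :=
    (integral_eq_iff_of_ae_le (hd.inf hp') hd (ae_of_all _ fun x => min_le_left _ _)).1
      (le_antisymm (integral_mono (hd.inf hp') hd fun x => min_le_left _ _) (hopt.trans hle))
  have hopen : IsOpen (Set.Ioo a b ∩ ⋂ i, {x | |x - p| < |x - y i|}) :=
    isOpen_Ioo.inter (isOpen_iInter_of_finite fun i =>
      isOpen_lt (by fun_prop) (by fun_prop))
  have hmem : p ∈ Set.Ioo a b ∩ ⋂ i, {x | |x - p| < |x - y i|} := by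
    refine ⟨hp, Set.mem_iInter.2 fun i => ?_⟩
    simp only [Set.mem_ofPred_eq, sub_self, abs_zero, abs_pos, sub_ne_zero]
    rintro rfl
    exact hpy ⟨i, rfl⟩
  obtain ⟨l, u, hlu, hsub⟩ := mem_nhds_iff_exists_Ioo_subset.1 (hopen.mem_nhds hmem)
  refine hpos l u (hlu.1.trans hlu.2) (fun x hx => hIS (hsub hx).1) ?_
  refine measure_mono_null (fun x hx => ?_) hae
  obtain ⟨i, hi⟩ := hTy x
  have hlt : |x - p| < |x - T x| := by
    rw [← hi]
    exact Set.mem_iInter.1 (hsub hx).2 i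
  simpa using hlt

lemma measure_Ioi_ne_zero_of_optimal (hk : 1 ≤ k) [IsProbabilityMeasure μ]
    (hint : Integrable (fun x : ℝ => |x|) μ)
    (hT : Measurable T) (hTy : ∀ x, T x ∈ Set.range y)
    (hopt : ∫ x, |x - T x| ∂μ ≤ projDist k μ) {j : Fin k} (hj : μ (T ⁻¹' {y j}) ≠ 0)
    {t : ℝ} (ht : t < y j) : μ (Set.Ioi t) ≠ 0 := by
  intro h0
  have hA : MeasurableSet (T ⁻¹' {y j}) := hT (measurableSet_singleton _)
  have hd := integrable_abs_sub_of_finite_range hint hT hTy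
  have hi : Integrable ((T ⁻¹' {y j}).indicator fun _ => y j - t) μ :=
    (integrable_const _).indicator hA
  have hle := projDist_le_integral_of_le hk hint (Function.update y j t) (hd.sub hi) (by
    filter_upwards [measure_eq_zero_iff_ae_notMem.1 h0] with x hx
    rw [Set.mem_Ioi, not_lt] at hx
    by_cases hyy : T x = y j
    · refine ⟨j, ?_⟩
      simp only [Function.update_self, Pi.sub_apply, Set.indicator, Set.mem_preimage, hyy,
        Set.mem_singleton_iff, if_true]
      rw [abs_of_nonpos (by linarith), abs_of_nonpos (by linarith)]
      linarith
    · obtain ⟨i, hyi⟩ := hTy x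
      have hij : i ≠ j := by
        rintro rfl
        exact hyy hyi.symm
      exact ⟨i, by simp [Function.update_of_ne hij, hyi, Set.indicator, hyy]⟩)
  rw [integral_sub' hd hi, integral_indicator_const _ hA, smul_eq_mul] at hle
  have hpos : 0 < μ.real (T ⁻¹' {y j}) := measureReal_nonneg.lt_of_ne'
    fun h => hj ((measureReal_eq_zero_iff).1 h)
  nlinarith

lemma measure_Iic_ne_zero_of_optimal (hk : 1 ≤ k) [IsProbabilityMeasure μ]
    (hint : Integrable (fun x : ℝ => |x|) μ)
    (hT : Measurable T) (hTy : ∀ x, T x ∈ Set.range y)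
    (hopt : ∫ x, |x - T x| ∂μ ≤ projDist k μ) {j : Fin k} (hj : μ (T ⁻¹' {y j}) ≠ 0) :
    μ (Set.Iic (y j)) ≠ 0 := by
  intro h0
  have hA : MeasurableSet (T ⁻¹' {y j}) := hT (measurableSet_singleton _)
  have hd := integrable_abs_sub_of_finite_range hint hT hTy
  have hpos : 0 < μ.real (T ⁻¹' {y j}) := measureReal_nonneg.lt_of_ne'
    fun h => hj ((measureReal_eq_zero_iff).1 h)
  obtain ⟨ε, hε, hsmall⟩ : ∃ ε > 0, μ.real (Set.Iic (y j + ε)) < μ.real (T ⁻¹' {y j}) / 2 := by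
    have hc := (ProbabilityTheory.cdf μ).right_continuous (y j)
    have h0' : ProbabilityTheory.cdf μ (y j) = 0 := by
      rw [ProbabilityTheory.cdf_eq_real, measureReal_def, h0, ENNReal.toReal_zero]
    have hev := (hc.mono Set.Ioi_subset_Ici_self).eventually_lt_const
      (h0'.trans_lt (half_pos hpos))
    obtain ⟨u, hu, hlt⟩ := (hev.and self_mem_nhdsWithin).exists
    refine ⟨u - y j, sub_pos.2 hlt, ?_⟩
    rwa [add_sub_cancel, ← ProbabilityTheory.cdf_eq_real]
  have hi : Integrable ((T ⁻¹' {y j}).indicator fun _ => ε) μ :=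
    (integrable_const _).indicator hA
  have hi' : Integrable ((Set.Iic (y j + ε)).indicator fun _ => 2 * ε) μ :=
    (integrable_const _).indicator measurableSet_Iic
  have hle := projDist_le_integral_of_le hk hint (Function.update y j (y j + ε))
    ((hd.sub hi).add hi') (by
    filter_upwards [measure_eq_zero_iff_ae_notMem.1 h0] with x hx
    rw [Set.mem_Iic, not_le] at hx
    by_cases hyy : T x = y j
    · refine ⟨j, ?_⟩
      simp only [Function.update_self, Pi.sub_apply, Pi.add_apply, Set.indicator,
        Set.mem_preimage, hyy, Set.mem_singleton_iff, if_true, Set.mem_Iic]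
      rw [abs_of_pos (sub_pos.2 hx), abs_le]
      split_ifs with h <;> constructor <;> linarith
    · obtain ⟨i, hyi⟩ := hTy x
      have hij : i ≠ j := by
        rintro rfl
        exact hyy hyi.symm
      refine ⟨i, ?_⟩
      simp only [Function.update_of_ne hij, Pi.sub_apply, Pi.add_apply, Set.indicator,
        Set.mem_preimage, hyy, Set.mem_singleton_iff, if_false, hyi]
      split_ifs <;> linarith)
  rw [integral_add' (hd.sub hi) hi', integral_sub' hd hi, integral_indicator_const _ hA,
    integral_indicator_const _ measurableSet_Iic, smul_eq_mul, smul_eq_mul] at hle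
  nlinarith

lemma measure_Ioc_ne_zero_of_optimal (hk : 1 ≤ k) [IsProbabilityMeasure μ]
    [NullSingletonClass μ] (hint : Integrable (fun x : ℝ => |x|) μ) {S : Set ℝ}
    (hS : S.OrdConnected) (hSc : μ Sᶜ = 0)
    (hpos : ∀ a b, a < b → Set.Ioo a b ⊆ S → μ (Set.Ioo a b) ≠ 0)
    (hT : Measurable T) (hTy : ∀ x, T x ∈ Set.range y)
    (hopt : ∫ x, |x - T x| ∂μ ≤ projDist k μ) (j : Fin k) {t : ℝ} (ht : t < y j) :
    μ (Set.Ioc t (y j)) ≠ 0 := by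
  intro h0
  have hj := measure_nearest_ne_zero hk hint hS hSc hpos hT hTy hopt j
  have hmeet : ∀ A : Set ℝ, μ A ≠ 0 → (A ∩ S).Nonempty := fun A hA => by
    by_contra h
    exact hA (measure_mono_null (fun x hxA hxS => h ⟨x, hxA, hxS⟩) hSc)
  have hr : μ (Set.Ioi (y j)) ≠ 0 := fun h => by
    refine measure_Ioi_ne_zero_of_optimal hk hint hT hTy hopt hj ht ?_
    rw [← Set.Ioc_union_Ioi_eq_Ioi ht.le]
    exact measure_union_null h0 h
  have hl : μ (Set.Iic t) ≠ 0 := fun h => by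
    refine measure_Iic_ne_zero_of_optimal hk hint hT hTy hopt hj ?_
    rw [← Set.Iic_union_Ioc_eq_Iic ht.le]
    exact measure_union_null h h0
  obtain ⟨a, ha, haS⟩ := hmeet _ hl
  obtain ⟨b, hb, hbS⟩ := hmeet _ hr
  exact hpos t (y j) ht
    (fun x hx => hS.out haS hbS ⟨ha.trans hx.1.le, hx.2.le.trans (le_of_lt hb)⟩)
    (measure_mono_null Set.Ioo_subset_Ioc_self h0)

end Optimal

/-- The weights of an optimal `k`-point measure are the `μ`-masses of the Voronoi
cells of its support points; equivalently, `ν* = ν_{Q_{vμ}}` with `vμ j = F_μ(y j)`. -/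
theorem stmt9 (μ : Measure ℝ) (hμ : BasicAssumptions μ)
    (hint : Integrable (fun x : ℝ => |x|) μ) {k : ℕ} (hk : 1 ≤ k)
    (w : Fin k → ℝ) (hw : ∀ j, 0 ≤ w j) (hw1 : ∑ j : Fin k, w j = 1)
    (y : Fin k → ℝ) (hy : StrictMono y) (νstar : Measure ℝ)
    (hνdef : νstar = ∑ j : Fin k, ENNReal.ofReal (w j) • Measure.dirac (y j))
    (hνPk : νstar ∈ Pk k) (hopt : W1 μ νstar = projDist k μ) :
    (∀ j : Fin k, w j = cellBd μ y ((j : ℕ) + 1) - cellBd μ y (j : ℕ)) ∧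
    νstar = nuQ μ (fun j => mcdf μ (y j)) := by
  have hprob : IsProbabilityMeasure μ := hμ.1
  have hν : IsProbabilityMeasure νstar := hνPk.1
  have hna := hμ.nullSingletonClass
  obtain ⟨S, hS, hSc, hpos⟩ := hμ.exists_ordConnected
  obtain ⟨T, hT, hTy, hTn⟩ := exists_measurable_nearest hk y
  have hνy : νstar (Set.range y)ᶜ = 0 := by
    simp [hνdef, Measure.dirac_apply' _ (Set.finite_range y).measurableSet.compl]
  have hopt' : ∫ x, |x - T x| ∂μ ≤ projDist k μ :=
    hopt ▸ integral_nearest_le_W1 hint hνy hT hTy hTn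
  have hW : W1 μ νstar ≤ ∫ x, |x - T x| ∂μ := hopt ▸ projDist_le_integral hT hTy
  have hatom : ∀ j, w j = νstar.real {y j} := fun j => by
    rw [measureReal_def, hνdef]
    simp [Set.indicator, hy.injective.eq_iff, ENNReal.toReal_ofReal, hw]
  have hle : ∀ j ∈ Finset.univ, w j ≤ cellBd μ y ((j : ℕ) + 1) - cellBd μ y (j : ℕ) := by
    intro j _
    rw [hatom]
    refine (measureReal_atom_le_measureReal_nearest hint hνy hT hTy hTn hW (y j)).trans
      ((measureReal_mono fun x hx i => ?_).trans (measureReal_voronoi_le hy j))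
    exact le_trans hx (hTn x i)
  have hweights : ∀ j : Fin k, w j = cellBd μ y ((j : ℕ) + 1) - cellBd μ y (j : ℕ) := fun j =>
    (Finset.sum_eq_sum_iff_of_le hle).1 (hw1.trans (sum_cellBd_sub hk μ y).symm) j
      (Finset.mem_univ j)
  refine ⟨hweights, ?_⟩
  have hq : ∀ j, mquantile μ (mcdf μ (y j)) = y j := fun j =>
    mquantile_mcdf fun t ht =>
      measure_Ioc_ne_zero_of_optimal hk hint hS hSc hpos hT hTy hopt' j ht
  simp only [nuQ, hq, hνdef, hweights]
end
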